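/- Let (X, d) be a compact metric space and T : X → X a continuous map with positive topological entropy h_top(T) > 0. Then there exists a nonempty compact perfect set E ⊆ X (a Cantor set) such that every pair of distinct points x, y ∈ E is DC2-scrambled for T. -/

import Mathlib

open Filter

/-- The fraction of times `i ∈ [0, n-1]` with `dist (T^[i] x) (T^[i] y) < t`. -/
noncomputable def closeTimesFraction {X : Type*} [MetricSpace X] (T : X → X)
    (x y : X) (t : ℝ) (n : ℕ) : ℝ :=
  (((Finset.range n).filter (fun i => dist (T^[i] x) (T^[i] y) < t)).card : ℝ) / n

/-- A pair `(x, y)` is DC2-scrambled for `T` if for every `t > 0` the upper density of times at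
which the orbits are `t`-close is `1`, while for some `t₀ > 0` the lower density of times at
which the orbits are `t₀`-close is less than `1`. -/
noncomputable def IsDC2Pair {X : Type*} [MetricSpace X] (T : X → X) (x y : X) : Prop :=
  (∀ t : ℝ, 0 < t →
      Filter.limsup (fun n : ℕ => closeTimesFraction T x y t n) Filter.atTop = 1) ∧
  (∃ t₀ : ℝ, 0 < t₀ ∧
      Filter.liminf (fun n : ℕ => closeTimesFraction T x y t₀ n) Filter.atTop < 1)

namespace DC2

open MeasureTheory

section FiniteIneq

lemma term_submod {p ac bc c : ℝ} (hp : 0 ≤ p) (h1 : p ≤ ac) (h2 : p ≤ bc) (h3 : p ≤ c) :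
    p * (Real.log ac + Real.log bc - Real.log p - Real.log c) ≤ ac * bc / c - p := by
  rcases hp.eq_or_lt with rfl | hp
  · simp only [zero_mul, sub_zero]; positivity
  · have hac : 0 < ac := hp.trans_le h1
    have hbc : 0 < bc := hp.trans_le h2
    have hc : 0 < c := hp.trans_le h3
    have e : Real.log ac + Real.log bc - Real.log p - Real.log c
        = Real.log (ac * bc / (p * c)) := by
      rw [Real.log_div (by positivity) (by positivity), Real.log_mul hac.ne' hbc.ne',
        Real.log_mul hp.ne' hc.ne']; ring
    rw [e]
    have := Real.log_le_sub_one_of_pos (show 0 < ac * bc / (p * c) by positivity)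
    calc p * Real.log (ac * bc / (p * c)) ≤ p * (ac * bc / (p * c) - 1) := by gcongr
      _ = ac * bc / c - p := by field_simp

lemma fin_submod {α β γ : Type*} [Fintype α] [Fintype β] [Fintype γ]
    (p : α → β → γ → ℝ) (hp : ∀ a b c, 0 ≤ p a b c) :
    ∑ a, ∑ b, ∑ c, Real.negMulLog (p a b c) + ∑ c, Real.negMulLog (∑ a, ∑ b, p a b c)
      ≤ ∑ a, ∑ c, Real.negMulLog (∑ b, p a b c) + ∑ b, ∑ c, Real.negMulLog (∑ a, p a b c) := by
  classical
  have e2 : ∑ c, Real.negMulLog (∑ a, ∑ b, p a b c)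
      = ∑ a, ∑ b, ∑ c, -(p a b c * Real.log (∑ a, ∑ b, p a b c)) := by
    have : ∀ c, Real.negMulLog (∑ a, ∑ b, p a b c) =
       ∑ a, ∑ b, -(p a b c * Real.log (∑ a, ∑ b, p a b c)) := by
      intro c
      simp only [Real.negMulLog, neg_mul, Finset.sum_neg_distrib, Finset.sum_mul]
    rw [Finset.sum_congr rfl (fun c _ => this c), Finset.sum_comm]
    refine Finset.sum_congr rfl fun a _ => ?_
    rw [Finset.sum_comm]
  have e3 : ∑ a, ∑ c, Real.negMulLog (∑ b, p a b c)
      = ∑ a, ∑ b, ∑ c, -(p a b c * Real.log (∑ b, p a b c)) := by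
    refine Finset.sum_congr rfl fun a _ => ?_
    rw [Finset.sum_comm]
    refine Finset.sum_congr rfl fun c _ => ?_
    simp only [Real.negMulLog, neg_mul, Finset.sum_neg_distrib, Finset.sum_mul]
  have e4 : ∑ b, ∑ c, Real.negMulLog (∑ a, p a b c)
      = ∑ a, ∑ b, ∑ c, -(p a b c * Real.log (∑ a, p a b c)) := by
    rw [Finset.sum_comm (s := Finset.univ (α := α))]
    refine Finset.sum_congr rfl fun a _ => ?_
    rw [Finset.sum_comm]
    refine Finset.sum_congr rfl fun c _ => ?_
    simp only [Real.negMulLog, neg_mul, Finset.sum_neg_distrib, Finset.sum_mul]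
  have key : ∑ a, ∑ b, ∑ c, p a b c * (Real.log (∑ b, p a b c) + Real.log (∑ a, p a b c)
      - Real.log (p a b c) - Real.log (∑ a, ∑ b, p a b c))
      ≤ ∑ a, ∑ b, ∑ c, ((∑ b, p a b c) * (∑ a, p a b c) / (∑ a, ∑ b, p a b c) - p a b c) := by
    refine Finset.sum_le_sum fun a _ => Finset.sum_le_sum fun b _ => Finset.sum_le_sum fun c _ => ?_
    have h1 : p a b c ≤ ∑ b, p a b c :=
      Finset.single_le_sum (f := fun b => p a b c) (fun b _ => hp a b c) (Finset.mem_univ b)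
    have h2 : p a b c ≤ ∑ a, p a b c :=
      Finset.single_le_sum (f := fun a => p a b c) (fun a _ => hp a b c) (Finset.mem_univ a)
    have h3 : ∑ b, p a b c ≤ ∑ a, ∑ b, p a b c :=
      Finset.single_le_sum (f := fun a => ∑ b, p a b c)
        (fun a _ => Finset.sum_nonneg fun b _ => hp a b c) (Finset.mem_univ a)
    exact term_submod (hp a b c) h1 h2 (h1.trans h3)
  have tot : ∑ a, ∑ b, ∑ c, ((∑ b, p a b c) * (∑ a, p a b c) / (∑ a, ∑ b, p a b c) - p a b c)
      = 0 := by
    have : ∀ c, ∑ a, ∑ b, ((∑ b, p a b c) * (∑ a, p a b c) / (∑ a, ∑ b, p a b c) - p a b c)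
        = 0 := by
      intro c
      simp only [Finset.sum_sub_distrib]
      have : ∑ a, ∑ b, (∑ b, p a b c) * (∑ a, p a b c) / (∑ a, ∑ b, p a b c)
          = (∑ a, ∑ b, p a b c) * (∑ b, ∑ a, p a b c) / (∑ a, ∑ b, p a b c) := by
        rw [Finset.sum_mul_sum, Finset.sum_div]
        refine Finset.sum_congr rfl fun a _ => ?_
        rw [Finset.sum_div]
      rw [this, Finset.sum_comm (f := fun b a => p a b c)]
      by_cases h : ∑ a, ∑ b, p a b c = 0
      · rw [h]; simp
      · field_simp; ring
    calc _ = ∑ c, ∑ a, ∑ b,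
        ((∑ b, p a b c) * (∑ a, p a b c) / (∑ a, ∑ b, p a b c) - p a b c) := by
          rw [Finset.sum_comm (s := Finset.univ (α := γ))]
          refine Finset.sum_congr rfl fun a _ => ?_
          rw [Finset.sum_comm]
      _ = 0 := Finset.sum_eq_zero fun c _ => this c
  rw [tot] at key
  rw [e2, e3, e4]
  rw [← sub_nonpos]
  simp only [← Finset.sum_add_distrib, ← Finset.sum_sub_distrib]
  refine le_trans (le_of_eq ?_) key
  refine Finset.sum_congr rfl fun a _ => Finset.sum_congr rfl fun b _ =>
    Finset.sum_congr rfl fun c _ => ?_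
  simp only [Real.negMulLog]; ring

lemma negMulLog_sum_le {β : Type*} (s : Finset β) (p : β → ℝ) (hp : ∀ b, 0 ≤ p b) :
    Real.negMulLog (∑ b ∈ s, p b) ≤ ∑ b ∈ s, Real.negMulLog (p b) := by
  simp only [Real.negMulLog, neg_mul, Finset.sum_neg_distrib, Finset.sum_mul, neg_le_neg_iff]
  refine Finset.sum_le_sum fun b hb => ?_
  rcases (hp b).eq_or_lt with h | h
  · simp [← h]
  · have : p b ≤ ∑ b ∈ s, p b := Finset.single_le_sum (fun b _ => hp b) hb
    gcongr

end FiniteIneq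

variable {X : Type*} [MeasurableSpace X]

/-- Shannon entropy of a finite-valued function. -/
noncomputable def Ent (ν : Measure X) {α : Type*} [Fintype α] (f : X → α) : ℝ :=
  ∑ a, Real.negMulLog (ν.real (f ⁻¹' {a}))

/-- All fibers are measurable. -/
def MF {α : Type*} (f : X → α) : Prop := ∀ a, MeasurableSet (f ⁻¹' {a})

lemma MF.preimage {α : Type*} [Finite α] {f : X → α} (hf : MF f) (s : Set α) :
    MeasurableSet (f ⁻¹' s) := by
  have : f ⁻¹' s = ⋃ a ∈ s, f ⁻¹' {a} := by ext; simp
  rw [this]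
  exact MeasurableSet.biUnion (Set.to_countable s) fun a _ => hf a

lemma MF.comp {α β : Type*} [Finite α] {f : X → α} (hf : MF f) (u : α → β) : MF (fun x => u (f x)) :=
  fun b => hf.preimage (u ⁻¹' {b})

lemma MF.prodMk {α β : Type*} {f : X → α} {g : X → β} (hf : MF f) (hg : MF g) :
    MF (fun x => (f x, g x)) := by
  rintro ⟨a, b⟩
  have : (fun x => (f x, g x)) ⁻¹' {(a, b)} = f ⁻¹' {a} ∩ g ⁻¹' {b} := by ext; simp
  rw [this]; exact (hf a).inter (hg b)

lemma MF.pi {ι : Type*} [Countable ι] {α : ι → Type*} {f : X → ∀ i, α i}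
    (hf : ∀ i, MF (fun x => f x i)) : MF f := by
  intro a
  have : f ⁻¹' {a} = ⋂ i, (fun x => f x i) ⁻¹' {a i} := by
    ext x; simp [funext_iff]
  rw [this]
  exact MeasurableSet.iInter fun i => hf i (a i)

lemma real_eq_sum (ν : Measure X) [IsFiniteMeasure ν] {β : Type*} [Fintype β] {g : X → β}
    (hg : MF g) (A : Set X) : ν.real A = ∑ b, ν.real (A ∩ g ⁻¹' {b}) := by
  have h := measure_biUnion_finset₀ (μ := ν.restrict A) (s := Finset.univ) (f := fun b => g ⁻¹' {b})
    (by
      intro a _ b _ hab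
      refine Disjoint.aedisjoint ?_
      rw [Set.disjoint_left]
      intro x hx hy
      simp at hx hy
      exact hab (hx.symm.trans hy))
    (fun b _ => (hg b).nullMeasurableSet)
  have hu : (⋃ b ∈ Finset.univ, g ⁻¹' {b}) = (Set.univ : Set X) := by ext; simp
  rw [hu, Measure.restrict_apply_univ] at h
  rw [Measure.real, h, ENNReal.toReal_sum (fun b _ => measure_ne_top _ _)]
  refine Finset.sum_congr rfl fun b _ => ?_
  rw [Measure.restrict_apply (hg b), Set.inter_comm]; rfl

lemma Ent_comp_le (ν : Measure X) [IsFiniteMeasure ν] {α β : Type*} [Fintype α] [Fintype β]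
    {g : X → β} (hg : MF g) (u : β → α) : Ent ν (fun x => u (g x)) ≤ Ent ν g := by
  classical
  unfold Ent
  have : ∀ a, Real.negMulLog (ν.real ((fun x => u (g x)) ⁻¹' {a})) ≤
      ∑ b, if u b = a then Real.negMulLog (ν.real (g ⁻¹' {b})) else 0 := by
    intro a
    rw [real_eq_sum ν hg]
    refine (negMulLog_sum_le _ _ (fun b => measureReal_nonneg)).trans ?_
    refine Finset.sum_le_sum fun b _ => ?_
    split_ifs with h
    · apply le_of_eq; congr 2
      ext x; simp; rintro rfl; exact h
    · have : (fun x => u (g x)) ⁻¹' {a} ∩ g ⁻¹' {b} = ∅ := by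
        ext x; simp; rintro h1 rfl; exact h h1
      rw [this]; simp
  refine (Finset.sum_le_sum fun a _ => this a).trans ?_
  rw [Finset.sum_comm]
  simp

lemma Ent_le_of_factor (ν : Measure X) [IsFiniteMeasure ν] {α β : Type*} [Fintype α] [Fintype β]
    {f : X → α} {g : X → β} (hg : MF g) (h : ∀ x y, g x = g y → f x = f y) :
    Ent ν f ≤ Ent ν g := by
  classical
  rcases isEmpty_or_nonempty X with hX | ⟨⟨x0⟩⟩
  · unfold Ent
    have h1 : ∀ A : Set X, ν.real A = 0 := fun A => by
      rw [Set.eq_empty_of_isEmpty A]; simp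
    simp [h1]
  · have : f = fun x => (Function.extend g f (fun _ => f x0)) (g x) := by
      funext x
      exact (Function.FactorsThrough.extend_apply (fun a b hab => h a b hab) _ x).symm
    rw [this]
    exact Ent_comp_le ν hg _

lemma Ent_eq_of_factor (ν : Measure X) [IsFiniteMeasure ν] {α β : Type*} [Fintype α] [Fintype β]
    {f : X → α} {g : X → β} (hf : MF f) (hg : MF g) (h : ∀ x y, g x = g y ↔ f x = f y) :
    Ent ν f = Ent ν g :=
  le_antisymm (Ent_le_of_factor ν hg fun x y => (h x y).1)
    (Ent_le_of_factor ν hf fun x y => (h x y).2)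

lemma Ent_submod (ν : Measure X) [IsFiniteMeasure ν] {α β γ : Type*} [Fintype α] [Fintype β]
    [Fintype γ] {f : X → α} {g : X → β} {k : X → γ} (hf : MF f) (hg : MF g) (hk : MF k) :
    Ent ν (fun x => (f x, g x, k x)) + Ent ν k ≤
      Ent ν (fun x => (f x, k x)) + Ent ν (fun x => (g x, k x)) := by
  have := fin_submod (fun a b c => ν.real (f ⁻¹' {a} ∩ g ⁻¹' {b} ∩ k ⁻¹' {c}))
    (fun _ _ _ => measureReal_nonneg)
  unfold Ent
  simp only [Fintype.sum_prod_type]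
  convert this using 2
  · refine Finset.sum_congr rfl fun a _ => Finset.sum_congr rfl fun b _ =>
      Finset.sum_congr rfl fun c _ => ?_
    congr 2
    ext x; simp [and_assoc]
  · refine Finset.sum_congr rfl fun c _ => ?_
    congr 1
    rw [real_eq_sum ν hf]
    refine Finset.sum_congr rfl fun a _ => ?_
    rw [real_eq_sum ν hg]
    refine Finset.sum_congr rfl fun b _ => ?_
    congr 1; ext x; simp; tauto
  · refine Finset.sum_congr rfl fun a _ => Finset.sum_congr rfl fun c _ => ?_
    congr 1
    rw [real_eq_sum ν hg]
    refine Finset.sum_congr rfl fun b _ => ?_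
    congr 1; ext x; simp; tauto
  · refine Finset.sum_congr rfl fun a _ => Finset.sum_congr rfl fun c _ => ?_
    congr 1
    rw [real_eq_sum ν hf]
    refine Finset.sum_congr rfl fun b _ => ?_
    congr 1; ext x; simp; tauto

lemma Ent_nonneg (ν : Measure X) [IsProbabilityMeasure ν] {α : Type*} [Fintype α] (f : X → α) :
    0 ≤ Ent ν f :=
  Finset.sum_nonneg fun _ _ => Real.negMulLog_nonneg measureReal_nonneg measureReal_le_one

end DC2

namespace DC2

open MeasureTheory

section SetFn

variable {X : Type*} [MeasurableSpace X] {ι : Type*}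

open Classical in
/-- Name map associated to a finite subfamily of sets. -/
noncomputable def nm (s : ι → Set X) (S : Finset ι) (x : X) : S → Bool :=
  fun i => decide (x ∈ s i)

lemma nm_eq_iff (s : ι → Set X) (S : Finset ι) (x y : X) :
    nm s S x = nm s S y ↔ ∀ i ∈ S, (x ∈ s i ↔ y ∈ s i) := by
  simp [nm, funext_iff]

lemma nm_MF {s : ι → Set X} (hs : ∀ i, MeasurableSet (s i)) (S : Finset ι) : MF (nm s S) := by
  classical
  refine MF.pi fun i => ?_
  intro b
  cases b
  · have : (fun x => nm s S x i) ⁻¹' {false} = (s i)ᶜ := by ext; simp [nm]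
    rw [this]; exact (hs i).compl
  · have : (fun x => nm s S x i) ⁻¹' {true} = s i := by ext; simp [nm]
    rw [this]; exact hs i

variable [DecidableEq ι]

/-- Entropy of the partition generated by a finite subfamily. -/
noncomputable def HS (ν : Measure X) (s : ι → Set X) (S : Finset ι) : ℝ := Ent ν (nm s S)

lemma HS_mono (ν : Measure X) [IsFiniteMeasure ν] {s : ι → Set X} (hs : ∀ i, MeasurableSet (s i))
    {S S' : Finset ι} (h : S ⊆ S') : HS ν s S ≤ HS ν s S' := by
  refine Ent_le_of_factor ν (nm_MF hs S') fun x y hxy => ?_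
  rw [nm_eq_iff] at hxy ⊢
  exact fun i hi => hxy i (h hi)

lemma HS_submod (ν : Measure X) [IsFiniteMeasure ν] {s : ι → Set X} (hs : ∀ i, MeasurableSet (s i))
    (S S' : Finset ι) : HS ν s (S ∪ S') + HS ν s (S ∩ S') ≤ HS ν s S + HS ν s S' := by
  have := Ent_submod ν (nm_MF hs S) (nm_MF hs S') (nm_MF hs (S ∩ S'))
  have h1 : HS ν s (S ∪ S') = Ent ν (fun x => (nm s S x, nm s S' x, nm s (S ∩ S') x)) := by
    unfold HS
    refine Ent_eq_of_factor ν (nm_MF hs _) ((nm_MF hs _).prodMk ((nm_MF hs _).prodMk (nm_MF hs _))) ?_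
    intro x y
    simp only [Prod.mk.injEq, nm_eq_iff, Finset.mem_union, Finset.mem_inter]
    grind
  have h2 : HS ν s S = Ent ν (fun x => (nm s S x, nm s (S ∩ S') x)) := by
    unfold HS
    refine Ent_eq_of_factor ν (nm_MF hs _) ((nm_MF hs _).prodMk (nm_MF hs _)) ?_
    intro x y
    simp only [Prod.mk.injEq, nm_eq_iff, Finset.mem_inter]
    grind
  have h3 : HS ν s S' = Ent ν (fun x => (nm s S' x, nm s (S ∩ S') x)) := by
    unfold HS
    refine Ent_eq_of_factor ν (nm_MF hs _) ((nm_MF hs _).prodMk (nm_MF hs _)) ?_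
    intro x y
    simp only [Prod.mk.injEq, nm_eq_iff, Finset.mem_inter]
    grind
  rw [h1, h2, h3]; exact this

/-- The family of preimages `T^{-i} B_j`. -/
def fam {X : Type*} (T : X → X) (B : ℕ → Set X) (q : ℕ × ℕ) : Set X := {x | T^[q.1] x ∈ B q.2}

lemma mem_fam {X : Type*} {T : X → X} {B : ℕ → Set X} {q : ℕ × ℕ} {x : X} :
    x ∈ fam T B q ↔ T^[q.1] x ∈ B q.2 := Iff.rfl

lemma fam_meas {T : X → X} (hT : Measurable T) {B : ℕ → Set X} (hB : ∀ j, MeasurableSet (B j))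
    (q : ℕ × ℕ) : MeasurableSet (fam T B q) := (hT.iterate q.1) (hB q.2)

/-- Shift of index sets. -/
def sh (S : Finset (ℕ × ℕ)) : Finset (ℕ × ℕ) := S.image fun q => (q.1 + 1, q.2)

lemma Ent_comp_mp {ν : Measure X} {T : X → X} (hT : MeasurePreserving T ν ν) {α : Type*}
    [Fintype α] {f : X → α} (hf : MF f) : Ent ν (fun x => f (T x)) = Ent ν f := by
  unfold Ent
  refine Finset.sum_congr rfl fun a _ => ?_
  congr 1
  exact hT.measureReal_preimage (hf a).nullMeasurableSet

lemma HS_shift {ν : Measure X} [IsFiniteMeasure ν] {T : X → X} (hT : MeasurePreserving T ν ν)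
    {B : ℕ → Set X} (hB : ∀ j, MeasurableSet (B j)) (S : Finset (ℕ × ℕ)) :
    HS ν (fam T B) (sh S) = HS ν (fam T B) S := by
  have hm := fam_meas hT.measurable hB
  unfold HS
  rw [← Ent_comp_mp hT (nm_MF hm S)]
  refine Ent_eq_of_factor ν (nm_MF hm _) ?_ ?_
  · intro a; exact hT.measurable (nm_MF hm S a)
  · intro x y
    simp only [nm_eq_iff, sh, Finset.mem_image, mem_fam]
    constructor
    · rintro h _ ⟨q, hq, rfl⟩
      exact h q hq
    · intro h q hq
      exact h _ ⟨q, hq, rfl⟩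

lemma HS_empty (ν : Measure X) [IsProbabilityMeasure ν] (s : ι → Set X) : HS ν s ∅ = 0 := by
  unfold HS Ent
  refine Finset.sum_eq_zero fun a _ => ?_
  have : nm s ∅ ⁻¹' {a} = Set.univ := by
    ext x; simp [eq_iff_true_of_subsingleton]
  rw [this]; simp

end SetFn

end DC2

namespace DC2

section Slow

/-- Monotone, submodular, shift-invariant set functions. -/
structure ShSub (H : Finset (ℕ × ℕ) → ℝ) : Prop where
  mono : ∀ {S S'}, S ⊆ S' → H S ≤ H S'
  submod : ∀ S S', H (S ∪ S') + H (S ∩ S') ≤ H S + H S'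
  shift : ∀ S, H (sh S) = H S
  empty : H ∅ = 0

/-- Rectangles. -/
def R (a b k : ℕ) : Finset (ℕ × ℕ) := Finset.Ico a b ×ˢ Finset.range k

lemma mem_R {a b k : ℕ} {q : ℕ × ℕ} : q ∈ R a b k ↔ (a ≤ q.1 ∧ q.1 < b) ∧ q.2 < k := by
  simp [R]

lemma mem_sh {S : Finset (ℕ × ℕ)} {q : ℕ × ℕ} : q ∈ sh S ↔ 1 ≤ q.1 ∧ (q.1 - 1, q.2) ∈ S := by
  simp only [sh, Finset.mem_image]
  constructor
  · rintro ⟨p, hp, rfl⟩; simpa using hp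
  · rintro ⟨h1, h2⟩
    exact ⟨_, h2, by ext <;> simp; omega⟩

variable {H : Finset (ℕ × ℕ) → ℝ}

/-- Conditioning decreases entropy. -/
lemma ShSub.cond_anti (hH : ShSub H) (A : Finset (ℕ × ℕ)) {B B' : Finset (ℕ × ℕ)} (h : B ⊆ B') :
    H (A ∪ B') - H B' ≤ H (A ∪ B) - H B := by
  have h1 := hH.submod (A ∪ B) B'
  have h2 : H B ≤ H ((A ∪ B) ∩ B') := hH.mono (by intro q hq; simp; exact ⟨Or.inr hq, h hq⟩)
  have h3 : A ∪ B ∪ B' = A ∪ B' := by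
    ext q; simp; constructor
    · rintro (h' | h' | h')
      · exact Or.inl h'
      · exact Or.inr (h h')
      · exact Or.inr h'
    · tauto
  rw [h3] at h1
  linarith

/-- Mutual information is monotone. -/
lemma ShSub.info_mono (hH : ShSub H) {A A' B B' : Finset (ℕ × ℕ)} (hA : A ⊆ A') (hB : B ⊆ B') :
    H A + H B - H (A ∪ B) ≤ H A' + H B' - H (A' ∪ B') := by
  have h1 := hH.cond_anti B' hA
  have h2 := hH.cond_anti A hB
  rw [Finset.union_comm B' A', Finset.union_comm B' A] at h1
  linarith

lemma ShSub.shift_iter (hH : ShSub H) (S : Finset (ℕ × ℕ)) (n : ℕ) : H (sh^[n] S) = H S := by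
  induction n with
  | zero => rfl
  | succ n ih => rw [Function.iterate_succ_apply', hH.shift, ih]

lemma mem_sh_iter {S : Finset (ℕ × ℕ)} {n : ℕ} {q : ℕ × ℕ} :
    q ∈ sh^[n] S ↔ n ≤ q.1 ∧ (q.1 - n, q.2) ∈ S := by
  induction n generalizing q with
  | zero => simp
  | succ n ih =>
    rw [Function.iterate_succ_apply', mem_sh, ih]
    simp only [Nat.sub_sub]
    rw [Nat.add_comm 1 n]
    constructor
    · rintro ⟨h1, h2, h3⟩; exact ⟨by omega, h3⟩
    · rintro ⟨h1, h2⟩; exact ⟨by omega, by omega, h2⟩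

lemma ShSub.eq_of_shift (hH : ShSub H) {S S' : Finset (ℕ × ℕ)} (n : ℕ)
    (h : ∀ i j, (i + n, j) ∈ S' ↔ (i, j) ∈ S) (h' : ∀ q ∈ S', n ≤ q.1) : H S' = H S := by
  rw [← hH.shift_iter S n]
  congr 1
  ext ⟨i, j⟩
  rw [mem_sh_iter]
  constructor
  · intro hq
    have := h' _ hq
    refine ⟨this, ?_⟩
    rw [← h]
    simpa [Nat.sub_add_cancel this] using hq
  · rintro ⟨h1, h2⟩
    rw [← h] at h2
    simpa [Nat.sub_add_cancel h1] using h2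

/-- `H_k(n)` -/
def Hk (H : Finset (ℕ × ℕ) → ℝ) (k n : ℕ) : ℝ := H (R 0 n k)

lemma ShSub.R_eq (hH : ShSub H) (a b k : ℕ) : H (R a b k) = Hk H k (b - a) := by
  refine hH.eq_of_shift a ?_ ?_
  · intro i j; simp only [mem_R]; omega
  · intro q hq; rw [mem_R] at hq; exact hq.1.1

lemma ShSub.Hk_anti (hH : ShSub H) (k : ℕ) : Antitone fun n => Hk H k (n + 1) - Hk H k n := by
  refine antitone_nat_of_succ_le fun n => ?_
  have h := hH.cond_anti (R 0 1 k) (show R 1 (n + 1) k ⊆ R 1 (n + 2) k by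
    intro q; simp only [mem_R]; omega)
  have e : ∀ n, R 0 1 k ∪ R 1 (n + 1) k = R 0 (n + 1) k := by
    intro n; ext q; simp only [mem_R, Finset.mem_union]; omega
  have e1 := e n
  have e2 := e (n + 1)
  have e3 := hH.R_eq 1 (n + 1) k
  have e4 := hH.R_eq 1 (n + 2) k
  simp only [Nat.add_sub_cancel] at e3 e4
  rw [e1, e3, e2, show H (R 1 (n + 2) k) = Hk H k (n + 1) from e4] at h
  exact h

/-- limiting increments -/
noncomputable def hk (H : Finset (ℕ × ℕ) → ℝ) (k : ℕ) : ℝ := ⨅ n, (Hk H k (n + 1) - Hk H k n)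

lemma ShSub.incr_nonneg (hH : ShSub H) (k n : ℕ) : 0 ≤ Hk H k (n + 1) - Hk H k n :=
  sub_nonneg.2 (hH.mono (by intro q; simp only [mem_R]; omega))

lemma ShSub.bdd (hH : ShSub H) (k : ℕ) : BddBelow (Set.range fun n => Hk H k (n + 1) - Hk H k n) :=
  ⟨0, by rintro _ ⟨n, rfl⟩; exact hH.incr_nonneg k n⟩

lemma ShSub.hk_le (hH : ShSub H) (k n : ℕ) : hk H k ≤ Hk H k (n + 1) - Hk H k n :=
  ciInf_le (hH.bdd k) n

lemma ShSub.hk_tendsto (hH : ShSub H) (k : ℕ) :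
    Tendsto (fun n => Hk H k (n + 1) - Hk H k n) atTop (nhds (hk H k)) :=
  tendsto_atTop_ciInf (hH.Hk_anti k) (hH.bdd k)

lemma ShSub.Hk_zero (hH : ShSub H) (k : ℕ) : Hk H k 0 = 0 := by
  have : R 0 0 k = ∅ := by ext q; simp [mem_R]
  rw [Hk, this, hH.empty]

lemma Hk_diff (k L n : ℕ) :
    Hk H k (L + n) - Hk H k L = ∑ i ∈ Finset.range n, (Hk H k (L + i + 1) - Hk H k (L + i)) := by
  exact (Finset.sum_range_sub (fun i => Hk H k (L + i)) n).symm

lemma ShSub.hk_mul_le (hH : ShSub H) (k L n : ℕ) :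
    n * hk H k ≤ Hk H k (L + n) - Hk H k L := by
  rw [Hk_diff]
  have := Finset.card_nsmul_le_sum (Finset.range n)
    (fun i => Hk H k (L + i + 1) - Hk H k (L + i)) (hk H k) (fun i _ => hH.hk_le k _)
  simpa using this

lemma ShSub.ek (hH : ShSub H) (k : ℕ) {ε : ℝ} (hε : 0 < ε) :
    ∃ n0, ∀ n ≥ n0, Hk H k n - n * hk H k ≤ ε * n := by
  have h := (hH.hk_tendsto k).cesaro
  have h2 := (h.eventually (gt_mem_nhds (show hk H k < hk H k + ε by linarith)))
  obtain ⟨n0, hn0⟩ := eventually_atTop.1 h2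
  refine ⟨max n0 1, fun n hn => ?_⟩
  have h3 := hn0 n (le_of_max_le_left hn)
  rw [Finset.sum_range_sub (fun i => Hk H k i), hH.Hk_zero, sub_zero] at h3
  have hn1 : (0 : ℝ) < n := by exact_mod_cast (le_of_max_le_right hn)
  rw [inv_mul_lt_iff₀ hn1] at h3
  linarith

/-- info between past and future at level `k` -/
lemma ShSub.info_le (hH : ShSub H) (k n N : ℕ) :
    H (R 0 n k) + H (R n N k) - H (R 0 n k ∪ R n N k) ≤ Hk H k n - n * hk H k := by
  rcases le_total n N with h | h
  · have e : R 0 n k ∪ R n N k = R 0 N k := by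
      ext q; simp only [mem_R, Finset.mem_union]; omega
    rw [e, hH.R_eq, hH.R_eq, hH.R_eq]
    have := hH.hk_mul_le k (N - n) n
    rw [Nat.sub_add_cancel h] at this
    simp only [Nat.sub_zero]
    linarith
  · have e : R n N k = ∅ := by ext q; simp [mem_R]; omega
    have := hH.hk_mul_le k 0 n
    rw [Nat.zero_add, hH.Hk_zero] at this
    rw [e, Finset.union_empty, hH.empty]
    linarith

/-- mixed rectangles -/
def Wf (H : Finset (ℕ × ℕ) → ℝ) (k a L : ℕ) : ℝ := H (R 0 a k ∪ R a (a + L) (k + 1))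

lemma ShSub.W_shift (hH : ShSub H) (k a L s : ℕ) :
    H (R s (s + a) k ∪ R (s + a) (s + a + L) (k + 1)) = Wf H k a L := by
  refine hH.eq_of_shift s ?_ ?_
  · intro i j; simp only [mem_R, Finset.mem_union]; omega
  · intro q; simp only [mem_R, Finset.mem_union]; omega

lemma ShSub.theta_mono (hH : ShSub H) (k : ℕ) {a a' L L' : ℕ} (ha : a ≤ a') (hL : a' + L ≤ a + L') :
    Wf H k (a + 1) L' - Wf H k a L' ≤ Wf H k (a' + 1) L - Wf H k a' L := by
  have h := hH.cond_anti (R 0 1 k)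
    (show R 1 (1 + a') k ∪ R (1 + a') (1 + a' + L) (k + 1) ⊆
      R 1 (1 + a) k ∪ R (1 + a) (1 + a + L') (k + 1) by
      intro q; simp only [mem_R, Finset.mem_union]; omega)
  rw [hH.W_shift, hH.W_shift] at h
  have e : ∀ a L, R 0 1 k ∪ (R 1 (1 + a) k ∪ R (1 + a) (1 + a + L) (k + 1))
      = R 0 (a + 1) k ∪ R (a + 1) (a + 1 + L) (k + 1) := by
    intro a L; ext q; simp only [mem_R, Finset.mem_union]; omega
  rw [e, e] at h
  exact h

lemma ShSub.theta_ge (hH : ShSub H) (k n L : ℕ) :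
    n * hk H k - (Hk H (k + 1) n - n * hk H (k + 1)) ≤
      n * (Wf H k n L - Wf H k (n - 1) L) := by
  rcases n with _ | n
  · simp [hH.Hk_zero]
  simp only [Nat.add_sub_cancel]
  set n' := n + 1 with hn'
  set L' := n + L
  have h1 : ∀ a ∈ Finset.range n', Wf H k (a + 1) L' - Wf H k a L'
      ≤ Wf H k n' L - Wf H k n L := by
    intro a ha
    have := Finset.mem_range.1 ha
    exact hH.theta_mono k (by omega) (by omega)
  have h2 := Finset.sum_le_card_nsmul _ _ _ h1
  rw [Finset.sum_range_sub (fun a => Wf H k a L')] at h2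
  simp only [Finset.card_range, nsmul_eq_mul] at h2
  refine le_trans ?_ h2
  have h3 := hH.info_le (k + 1) n' (n' + L')
  have h4 := hH.info_mono (A := R 0 n' k) (A' := R 0 n' (k + 1)) (B := R n' (n' + L') (k + 1))
    (by intro q; simp only [mem_R]; omega) subset_rfl
  have h5 := hH.hk_mul_le k 0 n'
  rw [Nat.zero_add, hH.Hk_zero] at h5
  have h6 : Wf H k 0 L' = H (R n' (n' + L') (k + 1)) := by
    rw [hH.R_eq]
    have : R 0 0 k ∪ R 0 (0 + L') (k + 1) = R 0 L' (k + 1) := by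
      ext q; simp only [mem_R, Finset.mem_union]; omega
    rw [Wf, this, Nat.add_sub_cancel_left]; rfl
  rw [h6]
  unfold Wf
  have h7 : H (R 0 n' k) = Hk H k n' := rfl
  linarith

lemma ShSub.step (hH : ShSub H) (k M : ℕ) {ε : ℝ} (hε : 0 < ε) :
    ∃ M0, M ≤ M0 ∧ ∀ M' ≥ M0, ∀ L,
      Hk H k (M' + L) - Hk H k (M' + L - M) - (Wf H k M' L - Wf H k (M' - M) L) ≤ ε := by
  set ε' := ε / (2 * (M + 1)) with hε'
  have hε'0 : 0 < ε' := by positivity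
  have hM1 : M * ε' ≤ ε / 2 := by
    rw [hε', mul_div_assoc', div_le_div_iff₀ (by positivity) (by positivity)]
    nlinarith
  obtain ⟨n0, hn0⟩ := hH.ek (k + 1) hε'0
  obtain ⟨n1, hn1⟩ := eventually_atTop.1
    ((hH.hk_tendsto k).eventually (gt_mem_nhds (show hk H k < hk H k + ε' by linarith)))
  refine ⟨M + n0 + n1, by omega, fun M' hM' L => ?_⟩
  have a1 : Hk H k (M' + L) - Hk H k (M' + L - M) ≤ M * (hk H k + ε') := by
    have e := Hk_diff (H := H) k (M' + L - M) M
    rw [Nat.sub_add_cancel (by omega)] at e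
    rw [e]
    have := Finset.sum_le_card_nsmul (Finset.range M)
      (fun i => Hk H k (M' + L - M + i + 1) - Hk H k (M' + L - M + i)) (hk H k + ε')
      (fun i _ => (hn1 _ (by omega)).le)
    rwa [Finset.card_range, nsmul_eq_mul] at this
  have a2 : M * (hk H k - ε') ≤ Wf H k M' L - Wf H k (M' - M) L := by
    have e : Wf H k M' L - Wf H k (M' - M) L
        = ∑ i ∈ Finset.range M, (Wf H k (M' - M + i + 1) L - Wf H k (M' - M + i) L) := by
      have := (Finset.sum_range_sub (fun i => Wf H k (M' - M + i) L) M).symm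
      rwa [Nat.sub_add_cancel (by omega)] at this
    rw [e]
    have := Finset.card_nsmul_le_sum (Finset.range M)
      (fun i => Wf H k (M' - M + i + 1) L - Wf H k (M' - M + i) L) (hk H k - ε')
      (fun i _ => by
        have b1 := hH.theta_ge k (M' - M + i + 1) L
        have b2 := hn0 (M' - M + i + 1) (by omega)
        rw [Nat.add_sub_cancel] at b1
        have b3 : (0 : ℝ) < (M' - M + i + 1 : ℕ) := by positivity
        refine le_of_mul_le_mul_left ?_ b3
        linarith)
    rwa [Finset.card_range, nsmul_eq_mul] at this
  linarith

/-- future index set for a resolution function -/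
def Zs (m : ℕ → ℕ) (n N : ℕ) : Finset (ℕ × ℕ) :=
  (Finset.Ico n N).biUnion fun i => (Finset.range (m i)).image fun j => (i, j)

lemma mem_Zs {m : ℕ → ℕ} {n N : ℕ} {q : ℕ × ℕ} :
    q ∈ Zs m n N ↔ (n ≤ q.1 ∧ q.1 < N) ∧ q.2 < m q.1 := by
  obtain ⟨i, j⟩ := q
  simp only [Zs, Finset.mem_biUnion, Finset.mem_Ico, Finset.mem_image, Finset.mem_range,
    Prod.mk.injEq]
  constructor
  · rintro ⟨i', h1, j', h2, rfl, rfl⟩; exact ⟨h1, h2⟩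
  · rintro ⟨h1, h2⟩; exact ⟨i, h1, j, h2, rfl, rfl⟩

/-- One refinement step of the future costs little. -/
lemma ShSub.refine_step (hH : ShSub H) {k M M' n N : ℕ} {ε : ℝ} (hε : 0 < ε)
    (hMM : M ≤ M')
    (hst : ∀ L, Hk H k (M' + L) - Hk H k (M' + L - M) - (Wf H k M' L - Wf H k (M' - M) L) ≤ ε)
    {A D D' : Finset (ℕ × ℕ)} (hA : A ⊆ R 0 n k) (hn : n ≤ M)
    (hD1 : D ⊆ R 0 N k) (hD2 : R M N k ⊆ D) (hD' : D' = R M' N (k + 1) ∪ D) :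
    H A + H D' - H (A ∪ D') ≤ H A + H D - H (A ∪ D) + ε := by
  set C := R M' N (k + 1) with hC
  rcases le_total M' N with hN | hN
  · obtain ⟨L, rfl⟩ := Nat.exists_eq_add_of_le hN
    have h1 := hH.cond_anti C hD2
    have h2 := hH.cond_anti C (show A ∪ D ⊆ R 0 (M' + L) k from
      Finset.union_subset (hA.trans (by intro q; simp only [mem_R]; omega)) hD1)
    have e1 : C ∪ R M (M' + L) k
        = R M (M + (M' - M)) k ∪ R (M + (M' - M)) (M + (M' - M) + L) (k + 1) := by
      ext q; simp only [hC, mem_R, Finset.mem_union]; omega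
    have e2 : C ∪ R 0 (M' + L) k = R 0 M' k ∪ R M' (M' + L) (k + 1) := by
      ext q; simp only [hC, mem_R, Finset.mem_union]; omega
    rw [e1, hH.W_shift, hH.R_eq] at h1
    rw [e2, show H (R 0 M' k ∪ R M' (M' + L) (k + 1)) = Wf H k M' L from rfl,
      show H (R 0 (M' + L) k) = Hk H k (M' + L) from rfl] at h2
    have h3 := hst L
    have e3 : A ∪ D' = C ∪ (A ∪ D) := by
      rw [hD']; ext q; simp only [Finset.mem_union]; tauto
    rw [e3, hD']
    linarith
  · have : C = ∅ := by ext q; simp [hC, mem_R]; omega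
    rw [hD', this, Finset.empty_union]; linarith

/-- Slowly growing resolution with small past-future information. -/
lemma ShSub.slow (hH : ShSub H) (k0 : ℕ) : ∃ m : ℕ → ℕ, Monotone m ∧ Tendsto m atTop atTop ∧
    (∀ i, k0 ≤ m i) ∧ ∃ δ : ℕ → ℝ, Tendsto δ atTop (nhds 0) ∧ ∀ n N,
      H (R 0 n k0) + H (Zs m n N) - H (R 0 n k0 ∪ Zs m n N) ≤ δ n * n + 2 := by
  choose F hF1 hF2 using fun (t M : ℕ) =>
    hH.step (k0 + t) M (show (0 : ℝ) < (1 / 2) ^ t by positivity)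
  choose E hE using fun t : ℕ => hH.ek (k0 + t + 1) (show (0 : ℝ) < 1 / (t + 1) by positivity)
  obtain ⟨M, M0, Ms⟩ : ∃ M : ℕ → ℕ, M 0 = 0 ∧
      ∀ t, M (t + 1) = F t (M t) + M t + 1 + E (t + 1) :=
    ⟨fun t => Nat.rec (motive := fun _ => ℕ) 0 (fun t Mt => F t Mt + Mt + 1 + E (t + 1)) t,
      rfl, fun t => rfl⟩
  have Mmono : StrictMono M := strictMono_nat_of_lt_succ fun t => by rw [Ms]; omega
  have Mge : ∀ t, t ≤ M t := Mmono.id_le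
  let lev : ℕ → ℕ := fun i => Nat.findGreatest (fun t => M t ≤ i) i
  have lev_iff : ∀ t i, t ≤ lev i ↔ M t ≤ i := by
    intro t i
    constructor
    · intro h
      exact (Mmono.monotone h).trans
        (Nat.findGreatest_spec (P := fun t => M t ≤ i) (m := 0) (n := i) (Nat.zero_le _)
          (show M 0 ≤ i by omega))
    · intro h
      exact Nat.le_findGreatest ((Mge t).trans h) h
  have lev_mono : Monotone lev := fun i j hij => by
    rw [lev_iff]; exact ((lev_iff _ i).1 le_rfl).trans hij
  have lev_top : Tendsto lev atTop atTop :=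
    tendsto_atTop_atTop.2 fun t => ⟨M t, fun i hi => (lev_iff t i).2 hi⟩
  refine ⟨fun i => k0 + lev i, fun i j hij => Nat.add_le_add_left (lev_mono hij) _,
    tendsto_atTop_mono (fun i => Nat.le_add_left _ _) lev_top, fun i => Nat.le_add_right _ _,
    fun n => 1 / ((lev n : ℝ) + 1) + if n < M 1 then H (R 0 n k0) else 0, ?_, ?_⟩
  · have := (tendsto_one_div_add_atTop_nhds_zero_nat (𝕜 := ℝ)).comp lev_top
    refine this.congr' ?_
    filter_upwards [eventually_ge_atTop (M 1)] with n hn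
    simp [not_lt.2 hn]
  intro n N
  beta_reduce
  by_cases hnM : n < M 1
  · have h1 : H (Zs (fun i => k0 + lev i) n N) ≤ H (R 0 n k0 ∪ Zs (fun i => k0 + lev i) n N) :=
      hH.mono Finset.subset_union_right
    rw [if_pos hnM]
    have h2 : 0 ≤ H (R 0 n k0) := by rw [← hH.empty]; exact hH.mono (Finset.empty_subset _)
    have h3 : H (R 0 n k0) ≤ H (R 0 n k0) * n := by
      rcases n with _ | n
      · have : R 0 0 k0 = ∅ := by ext q; simp [mem_R]
        simp [this, hH.empty]
      · push_cast; nlinarith [(Nat.cast_nonneg n : (0 : ℝ) ≤ n)]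
    have h4 : 0 ≤ 1 / ((lev n : ℝ) + 1) * n := by positivity
    linarith
  rw [if_neg hnM, add_zero]
  set t := lev n with ht
  have htn : M t ≤ n := (lev_iff t n).1 le_rfl
  have htn' : n < M (t + 1) := by
    by_contra h
    have := (lev_iff (t + 1) n).2 (not_lt.1 h)
    omega
  -- truncated futures
  let Zt : ℕ → Finset (ℕ × ℕ) := fun s => Zs (fun i => min (k0 + lev i) (k0 + s)) n N
  have base : H (R 0 n k0) + H (Zt (t + 1)) - H (R 0 n k0 ∪ Zt (t + 1)) ≤ 1 / ((t : ℝ) + 1) * n := by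
    have h1 := hH.info_mono (A := R 0 n k0) (A' := R 0 n (k0 + t + 1)) (B := Zt (t + 1))
      (B' := R n N (k0 + t + 1)) (by intro q; simp only [mem_R]; omega)
      (by intro q; simp only [Zt, mem_Zs, mem_R]; omega)
    refine h1.trans ((hH.info_le _ _ _).trans ?_)
    rcases t with _ | t
    · exact absurd htn' hnM
    · refine hE (t + 1) n ?_
      rw [Ms] at htn; omega
  have ind : ∀ s, H (R 0 n k0) + H (Zt (t + 1 + s)) - H (R 0 n k0 ∪ Zt (t + 1 + s)) ≤
      1 / ((t : ℝ) + 1) * n + ∑ i ∈ Finset.range s, (1 / 2 : ℝ) ^ i := by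
    intro s
    induction s with
    | zero => simpa using base
    | succ s ih =>
      rw [Finset.sum_range_succ]
      have := hH.refine_step (k := k0 + (t + 1 + s)) (M := M (t + 1 + s)) (M' := M (t + 1 + s + 1))
        (n := n) (N := N) (A := R 0 n k0) (D := Zt (t + 1 + s)) (D' := Zt (t + 1 + (s + 1)))
        (ε := (1 / 2) ^ (t + 1 + s)) (by positivity)
        (Mmono.monotone (Nat.le_succ _))
        (fun L => hF2 (t + 1 + s) (M (t + 1 + s)) _ (by rw [Ms]; omega) L)
        (by intro q; simp only [mem_R]; omega)
        (htn'.le.trans (Mmono.monotone (by omega)))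
        (by intro q; simp only [Zt, mem_Zs, mem_R]; omega)
        (by
          intro q; simp only [Zt, mem_Zs, mem_R]
          rintro ⟨⟨h1, h2⟩, h3⟩
          have h4 := (lev_iff (t + 1 + s) q.1).2 h1
          have h5 : M (t + 1) ≤ M (t + 1 + s) := Mmono.monotone (by omega)
          omega)
        (by
          ext q; simp only [Zt, mem_Zs, mem_R, Finset.mem_union]
          have h4 := (lev_iff (t + 1 + s + 1) q.1)
          have h5 : M (t + 1) ≤ M (t + 1 + s + 1) := Mmono.monotone (by omega)
          constructor
          · rintro ⟨h1, h2⟩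
            by_cases h : t + 1 + s + 1 ≤ lev q.1
            · left; have := h4.1 h; omega
            · right; omega
          · rintro (⟨⟨h1, h2⟩, h3⟩ | h)
            · have := h4.2 h1; omega
            · omega)
      have h6 : (1 / 2 : ℝ) ^ (t + 1 + s) ≤ (1 / 2) ^ s :=
        pow_le_pow_of_le_one (by norm_num) (by norm_num) (by omega)
      linarith
  have fin : Zs (fun i => k0 + lev i) n N = Zt (t + 1 + N) := by
    ext q; simp only [Zt, mem_Zs]
    have : lev q.1 ≤ q.1 := Nat.findGreatest_le _
    omega
  have hsum : ∑ i ∈ Finset.range N, (1 / 2 : ℝ) ^ i ≤ 2 := by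
    have := geom_sum_eq (show (1 / 2 : ℝ) ≠ 1 by norm_num) N
    rw [this]
    have : (0 : ℝ) < (1 / 2) ^ N := by positivity
    rw [div_le_iff_of_neg (by norm_num)]; linarith
  rw [fin]
  linarith [ind N]

end Slow

end DC2

namespace DC2

open MeasureTheory

section KeyIneq

lemma key_term {g p pw pf K : ℝ} (hg : 0 ≤ g) (hgp : g ≤ p) (h1 : p ≤ pw) (h2 : p ≤ pf)
    (hK : 1 ≤ K) :
    -(g * Real.log pw) ≤ p * (Real.log p - Real.log pw - Real.log pf) + pw * pf + g * Real.log K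
      + (if 0 < g then pf / K else 0) := by
  rcases (hg.trans hgp).eq_or_lt with hp | hp
  · have : g = 0 := le_antisymm (hp ▸ hgp) hg
    subst this
    rw [← hp]
    have : 0 ≤ pw * pf := by rw [← hp] at h1 h2; positivity
    simpa using this
  have hpw : 0 < pw := hp.trans_le h1
  have hpf : 0 < pf := hp.trans_le h2
  have hK0 : 0 < K := by linarith
  have a1 : (p - g) * (Real.log pw + Real.log pf - Real.log p) ≤ pw * pf := by
    have e : Real.log pw + Real.log pf - Real.log p = Real.log (pw * pf / p) := by
      rw [Real.log_div (by positivity) hp.ne', Real.log_mul hpw.ne' hpf.ne']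
    rw [e]
    have := Real.log_le_sub_one_of_pos (show 0 < pw * pf / p by positivity)
    calc (p - g) * Real.log (pw * pf / p) ≤ (p - g) * (pw * pf / p) := by
          gcongr
          · linarith
      _ ≤ p * (pw * pf / p) := by gcongr; linarith
      _ = pw * pf := by field_simp
  have a2 : g * (Real.log pf - Real.log p - Real.log K) ≤ if 0 < g then pf / K else 0 := by
    split_ifs with hg0
    · have e : Real.log pf - Real.log p - Real.log K = Real.log (pf / p / K) := by
        rw [Real.log_div (by positivity) hK0.ne', Real.log_div hpf.ne' hp.ne']
      rw [e]
      have := Real.log_le_sub_one_of_pos (show 0 < pf / p / K by positivity)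
      calc g * Real.log (pf / p / K) ≤ g * (pf / p / K) := by gcongr; linarith
        _ ≤ p * (pf / p / K) := by gcongr
        _ = pf / K := by field_simp
    · have : g = 0 := le_antisymm (not_lt.1 hg0) hg
      simp [this]
  nlinarith

variable {X : Type*} [MeasurableSpace X]

open Classical in
lemma key_ineq (μ : Measure X) [IsProbabilityMeasure μ] {α β : Type*} [Fintype α] [Fintype β]
    {w : X → α} {f : X → β} (hw : MF w) (hf : MF f) {G : Set X}
    (K : β → ℝ) (hK1 : ∀ b, 1 ≤ K b)
    (hK : ∀ b, ((Finset.univ.filter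
      fun a => 0 < μ.real (G ∩ w ⁻¹' {a} ∩ f ⁻¹' {b})).card : ℝ) ≤ K b) :
    ∑ a, μ.real (G ∩ w ⁻¹' {a}) * (-Real.log (μ.real (w ⁻¹' {a}))) ≤
      ∑ b, μ.real (G ∩ f ⁻¹' {b}) * Real.log (K b) + 1
        + (Ent μ w + Ent μ f - Ent μ (fun x => (w x, f x))) + 1 := by
  set p : α → β → ℝ := fun a b => μ.real (w ⁻¹' {a} ∩ f ⁻¹' {b}) with hp
  set g : α → β → ℝ := fun a b => μ.real (G ∩ w ⁻¹' {a} ∩ f ⁻¹' {b}) with hg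
  set pw : α → ℝ := fun a => μ.real (w ⁻¹' {a}) with hpw
  set pf : β → ℝ := fun b => μ.real (f ⁻¹' {b}) with hpf
  have e1 : ∀ a, μ.real (G ∩ w ⁻¹' {a}) = ∑ b, g a b := fun a => real_eq_sum μ hf _
  have e2 : ∀ b, μ.real (G ∩ f ⁻¹' {b}) = ∑ a, g a b := fun b => by
    rw [real_eq_sum μ hw]
    refine Finset.sum_congr rfl fun a _ => ?_
    simp only [hg]; congr 1; ext x; simp; tauto
  have e3 : ∀ a, pw a = ∑ b, p a b := fun a => real_eq_sum μ hf _
  have e4 : ∀ b, pf b = ∑ a, p a b := fun b => by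
    simp only [hpf]
    rw [real_eq_sum μ hw]
    refine Finset.sum_congr rfl fun a _ => ?_
    simp only [hp]; congr 1; ext x; simp; tauto
  have hp0 : ∀ a b, 0 ≤ p a b := fun a b => measureReal_nonneg
  have e5 : ∑ a, pw a = 1 := by
    have := real_eq_sum μ hw Set.univ
    simp only [Set.univ_inter] at this
    rw [← this]; simp
  have e6 : ∑ b, pf b = 1 := by
    have := real_eq_sum μ hf Set.univ
    simp only [Set.univ_inter] at this
    rw [← this]; simp
  have T := Finset.sum_le_sum fun a (_ : a ∈ Finset.univ) => Finset.sum_le_sum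
    fun b (_ : b ∈ Finset.univ) =>
    key_term (g := g a b) (p := p a b) (pw := pw a) (pf := pf b) (K := K b) measureReal_nonneg
      (measureReal_mono (by intro x hx; exact ⟨hx.1.2, hx.2⟩))
      (measureReal_mono Set.inter_subset_left) (measureReal_mono Set.inter_subset_right) (hK1 b)
  simp only [Finset.sum_add_distrib, mul_sub, Finset.sum_sub_distrib] at T
  have t1 : ∑ a, ∑ b, -(g a b * Real.log (pw a)) =
      ∑ a, μ.real (G ∩ w ⁻¹' {a}) * (-Real.log (pw a)) := by
    refine Finset.sum_congr rfl fun a _ => ?_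
    rw [e1, Finset.sum_mul]
    exact Finset.sum_congr rfl fun b _ => by ring
  have t2 : ∑ a, ∑ b, p a b * Real.log (p a b) = - Ent μ (fun x => (w x, f x)) := by
    unfold Ent
    rw [Fintype.sum_prod_type]
    simp only [← Finset.sum_neg_distrib]
    refine Finset.sum_congr rfl fun a _ => Finset.sum_congr rfl fun b _ => ?_
    have : (fun x => (w x, f x)) ⁻¹' {(a, b)} = w ⁻¹' {a} ∩ f ⁻¹' {b} := by ext; simp
    rw [this]; simp [Real.negMulLog, hp]
  have t3 : ∑ a, ∑ b, p a b * Real.log (pw a) = - Ent μ w := by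
    unfold Ent
    simp only [← Finset.sum_neg_distrib]
    refine Finset.sum_congr rfl fun a _ => ?_
    rw [← Finset.sum_mul, ← e3]
    simp [Real.negMulLog, hpw]
  have t4 : ∑ a, ∑ b, p a b * Real.log (pf b) = - Ent μ f := by
    rw [Finset.sum_comm]
    unfold Ent
    simp only [← Finset.sum_neg_distrib]
    refine Finset.sum_congr rfl fun a _ => ?_
    rw [← Finset.sum_mul, ← e4]
    simp [Real.negMulLog, hpf]
  have t5 : ∑ a, ∑ b, pw a * pf b = 1 := by
    rw [← Finset.sum_mul_sum, e5, e6, one_mul]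
  have t6 : ∑ a, ∑ b, g a b * Real.log (K b) = ∑ b, μ.real (G ∩ f ⁻¹' {b}) * Real.log (K b) := by
    rw [Finset.sum_comm]
    refine Finset.sum_congr rfl fun b _ => ?_
    rw [e2, Finset.sum_mul]
  have t7 : ∑ a, ∑ b, (if 0 < g a b then pf b / K b else 0) ≤ 1 := by
    rw [Finset.sum_comm, ← e6]
    refine Finset.sum_le_sum fun b _ => ?_
    rw [← Finset.sum_filter, Finset.sum_const, nsmul_eq_mul]
    have hKb : 0 < K b := by linarith [hK1 b]
    rw [mul_div_assoc', div_le_iff₀ hKb, mul_comm]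
    exact mul_le_mul_of_nonneg_left (hK b) measureReal_nonneg
  rw [t1, t2, t3, t4, t5, t6] at T
  linarith

lemma simple_bound (μ : Measure X) [IsProbabilityMeasure μ] {α : Type*} [Fintype α] [Nonempty α]
    {w : X → α} (hw : MF w) (G : Set X) :
    ∑ a, μ.real (G ∩ w ⁻¹' {a}) * (-Real.log (μ.real (w ⁻¹' {a}))) ≤
      μ.real G * Real.log (Fintype.card α) + 2 := by
  classical
  have hf : MF (fun _ : X => ()) := fun a => by simp
  have := key_ineq μ hw hf (G := G) (fun _ => (Fintype.card α : ℝ))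
    (fun _ => by exact_mod_cast Fintype.card_pos)
    (fun b => by exact_mod_cast Finset.card_le_univ _)
  have e : Ent μ (fun x => (w x, ())) = Ent μ w :=
    Ent_eq_of_factor μ (hw.prodMk hf) hw (by intro x y; simp)
  have e2 : Ent μ (fun _ : X => ()) = 0 := by simp [Ent]
  rw [e, e2] at this
  simp at this ⊢
  linarith

end KeyIneq

lemma hamming_count {A : Type*} [Fintype A] [DecidableEq A] (n : ℕ) (w0 : Fin n → A) (d : ℕ)
    {l : ℝ} (hl : 0 < l) (hl1 : l ≤ 1) :
    ((Finset.univ.filter fun w : Fin n → A => hammingDist w w0 ≤ d).card : ℝ) ≤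
      (l⁻¹) ^ d * (1 + Fintype.card A * l) ^ n := by
  have h1 : ∑ w : Fin n → A, l ^ (hammingDist w w0) ≤ (1 + Fintype.card A * l) ^ n := by
    have : ∀ w : Fin n → A, l ^ (hammingDist w w0) = ∏ i, (if w i ≠ w0 i then l else 1) := by
      intro w
      rw [Finset.prod_ite]; simp [hammingDist]
    simp only [this]
    rw [← Fintype.prod_sum (fun i (a : A) => if a ≠ w0 i then l else 1)]
    calc _ ≤ ∏ i : Fin n, (1 + Fintype.card A * l) := by
          refine Finset.prod_le_prod (fun i _ => Finset.sum_nonneg fun a _ => ?_) fun i _ => ?_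
          · split_ifs <;> positivity
          · calc ∑ a, (if a ≠ w0 i then l else 1) ≤ ∑ a, ((if a = w0 i then 1 else 0) + l) := by
                  refine Finset.sum_le_sum fun a _ => ?_
                  by_cases h : a = w0 i <;> simp [h, hl.le]
              _ = _ := by simp [Finset.sum_add_distrib]
      _ = _ := by simp
  have h2 : ((Finset.univ.filter fun w : Fin n → A => hammingDist w w0 ≤ d).card : ℝ) * l ^ d ≤
      ∑ w : Fin n → A, l ^ (hammingDist w w0) := by
    rw [← nsmul_eq_mul, ← Finset.sum_const]
    refine (Finset.sum_le_sum fun w hw => ?_).trans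
      (Finset.sum_le_sum_of_subset_of_nonneg (Finset.filter_subset _ _) fun w _ _ => by positivity)
    exact pow_le_pow_of_le_one hl.le hl1 (Finset.mem_filter.1 hw).2
  rw [inv_pow, ← div_eq_inv_mul, le_div_iff₀ (by positivity)]
  exact h2.trans h1

end DC2

namespace DC2

open MeasureTheory

section Net

lemma exists_net {X : Type*} [MetricSpace X] [CompactSpace X] (T : X → X)
    (hent : 0 < Dynamics.coverEntropy T (Set.univ : Set X)) :
    ∃ ε0 > 0, ∃ h : ℝ, 0 < h ∧ ∃ᶠ N : ℕ in atTop, ∃ S : Finset X, Real.exp (h * N) ≤ S.card ∧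
      ∀ x ∈ S, ∀ y ∈ S, x ≠ y → ∃ i < N, ε0 ≤ dist (T^[i] x) (T^[i] y) := by
  rw [Dynamics.coverEntropy_eq_iSup_basis_netEntropyEntourage Metric.uniformity_basis_dist] at hent
  obtain ⟨ε0, hent⟩ := lt_iSup_iff.1 hent
  obtain ⟨hε0, hent⟩ := lt_iSup_iff.1 hent
  obtain ⟨h, hh0, hh⟩ := EReal.lt_iff_exists_real_btwn.1 hent
  have hh0' : 0 < h := by exact_mod_cast hh0
  refine ⟨ε0, hε0, h / 2, by positivity, ?_⟩
  have hf := (ExpGrowth.frequently_exp_le hh).and_eventually (eventually_gt_atTop 0)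
  refine hf.mono fun N hN => ?_
  obtain ⟨hN, hN0⟩ := hN
  have hlt : Real.exp (h / 2 * N) < Real.exp (h * N) := by
    apply Real.exp_lt_exp.2
    have : (0 : ℝ) < N := by exact_mod_cast hN0
    nlinarith
  have e1 : EReal.exp ((h : EReal) * N) = ENNReal.ofReal (Real.exp (h * N)) := by
    rw [← EReal.exp_coe]; push_cast; rfl
  rw [e1] at hN
  have h2 : ∃ S : Finset X, Dynamics.IsDynNetIn T Set.univ {p | dist p.1 p.2 < ε0} N (S : Set X) ∧
      Real.exp (h / 2 * N) ≤ S.card := by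
    by_contra hcon
    push Not at hcon
    have : Dynamics.netMaxcard T Set.univ {p | dist p.1 p.2 < ε0} N
        ≤ (⌊Real.exp (h / 2 * N)⌋₊ : ℕ) := by
      unfold Dynamics.netMaxcard
      refine iSup₂_le fun S hS => ?_
      have := hcon S hS
      exact_mod_cast Nat.le_floor this.le
    have h3 : ENNReal.ofReal (Real.exp (h * N)) ≤ ((⌊Real.exp (h / 2 * N)⌋₊ : ℕ) : ENNReal) := by
      refine hN.trans ?_
      have := ENat.toENNReal_mono this
      simpa using this
    rw [ENNReal.ofReal_le_iff_le_toReal (by simp)] at h3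
    simp only [ENNReal.toReal_natCast] at h3
    have := Nat.floor_le (Real.exp_pos (h / 2 * N)).le
    linarith
  obtain ⟨S, hS, hc⟩ := h2
  refine ⟨S, hc, fun x hx y hy hxy => ?_⟩
  have := hS.2 hx hy hxy
  by_contra hcon
  push Not at hcon
  have a1 : y ∈ UniformSpace.ball x (Dynamics.dynEntourage T {p | dist p.1 p.2 < ε0} N) := by
    rw [Dynamics.mem_ball_dynEntourage]
    intro k hk
    exact hcon k hk
  have a2 : y ∈ UniformSpace.ball y (Dynamics.dynEntourage T {p | dist p.1 p.2 < ε0} N) := by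
    rw [Dynamics.mem_ball_dynEntourage]
    intro k hk
    simpa [UniformSpace.ball] using hε0
  exact Set.disjoint_left.1 this a1 a2

end Net

section Inv

variable {X : Type*} [MeasurableSpace X]

/-- Time averages. -/
noncomputable def avg (σ : Measure X) (T : X → X) (N : ℕ) : Measure X :=
  (N : ENNReal)⁻¹ • ∑ t ∈ Finset.range N, σ.map T^[t]

lemma avg_real (σ : Measure X) [IsProbabilityMeasure σ] {T : X → X} (hT : Measurable T) (N : ℕ)
    {A : Set X} (hA : MeasurableSet A) :
    (avg σ T N).real A = ∑ t ∈ Finset.range N, (N : ℝ)⁻¹ * σ.real (T^[t] ⁻¹' A) := by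
  rw [Measure.real, avg]
  simp only [Measure.smul_apply, Measure.coe_finsetSum, Finset.sum_apply, smul_eq_mul,
    ENNReal.toReal_mul, ENNReal.toReal_inv, ENNReal.toReal_natCast]
  rw [ENNReal.toReal_sum, Finset.mul_sum]
  · refine Finset.sum_congr rfl fun t _ => ?_
    rw [Measure.map_apply (hT.iterate t) hA]; rfl
  · intro t _
    rw [Measure.map_apply (hT.iterate t) hA]; exact measure_ne_top _ _

lemma avg_prob (σ : Measure X) [IsProbabilityMeasure σ] {T : X → X} (hT : Measurable T) {N : ℕ}
    (hN : 0 < N) : IsProbabilityMeasure (avg σ T N) := by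
  constructor
  rw [avg]
  simp only [Measure.smul_apply, Measure.coe_finsetSum, Finset.sum_apply, smul_eq_mul]
  have : ∀ t ∈ Finset.range N, σ.map T^[t] Set.univ = 1 := fun t _ => by
    rw [Measure.map_apply (hT.iterate t) MeasurableSet.univ]; simp
  rw [Finset.sum_congr rfl this]
  simp only [Finset.sum_const, Finset.card_range, nsmul_eq_mul, mul_one]
  exact ENNReal.inv_mul_cancel (by exact_mod_cast hN.ne') (by simp)

lemma Ent_le_card (ν : Measure X) {α : Type*} [Fintype α] (f : X → α) :
    Ent ν f ≤ Fintype.card α := by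
  unfold Ent
  rw [← nsmul_one, ← Finset.card_univ]
  refine Finset.sum_le_card_nsmul _ _ _ fun a _ => ?_
  set x := ν.real (f ⁻¹' {a})
  have hx : 0 ≤ x := measureReal_nonneg
  rcases hx.eq_or_lt with h | h
  · rw [← h]; simp
  · have := Real.one_sub_inv_le_log_of_pos h
    rw [Real.negMulLog, neg_mul]
    have h2 : x * (1 - x⁻¹) ≤ x * Real.log x := by gcongr
    rw [mul_sub, mul_inv_cancel₀ h.ne'] at h2
    linarith

lemma Ent_avg (σ : Measure X) [IsProbabilityMeasure σ] {T : X → X} (hT : Measurable T) {N : ℕ}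
    (hN : 0 < N) {α : Type*} [Fintype α] {f : X → α} (hf : MF f) :
    ∑ t ∈ Finset.range N, (N : ℝ)⁻¹ * Ent σ (fun x => f (T^[t] x)) ≤ Ent (avg σ T N) f := by
  unfold Ent
  simp only [Finset.mul_sum]
  rw [Finset.sum_comm]
  refine Finset.sum_le_sum fun a _ => ?_
  rw [avg_real σ hT N (hf a)]
  have := Real.concaveOn_negMulLog.le_map_sum (t := Finset.range N) (w := fun _ => (N : ℝ)⁻¹)
    (p := fun t => σ.real (T^[t] ⁻¹' (f ⁻¹' {a}))) (fun i _ => by positivity)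
    (by simp [hN.ne']) (fun i _ => measureReal_nonneg)
  simp only [smul_eq_mul] at this
  exact this

lemma HS_avg (σ : Measure X) [IsProbabilityMeasure σ] {T : X → X} (hT : Measurable T) {N : ℕ}
    (hN : 0 < N) {B : ℕ → Set X} (hB : ∀ j, MeasurableSet (B j)) (n p : ℕ) :
    n * HS σ (fam T B) (R 0 N p) ≤
      N * HS (avg σ T N) (fam T B) (R 0 n p) + n * Fintype.card ((R 0 n p) → Bool) := by
  have hm := fam_meas hT hB
  set Hh := HS σ (fam T B)
  have h0 : Hh ∅ = 0 := HS_empty σ _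
  have e1 : ∀ t, Ent σ (fun x => nm (fam T B) (R 0 n p) (T^[t] x)) = Hh (R t (t + n) p) := by
    intro t
    refine Ent_eq_of_factor σ ((?_ : MF _)) (nm_MF hm _) ?_
    · intro a
      exact (hT.iterate t) (nm_MF hm (R 0 n p) a)
    · intro x y
      simp only [nm_eq_iff, mem_R, mem_fam, ← Function.iterate_add_apply]
      constructor
      · intro h q hq
        exact h (q.1 + t, q.2) (by simp; omega)
      · intro h q hq
        have := h (q.1 - t, q.2) (by simp; omega)
        simpa [Nat.sub_add_cancel hq.1.1] using this
  have h1 := Ent_avg σ hT hN (nm_MF hm (R 0 n p))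
  simp only [e1] at h1
  rw [← Finset.mul_sum, inv_mul_le_iff₀ (by exact_mod_cast hN)] at h1
  have h2 : ∀ t, Hh (R 0 (t + n) p) - Hh (R 0 t p) ≤ Hh (R t (t + n) p) := by
    intro t
    have := HS_submod σ hm (R 0 t p) (R t (t + n) p)
    have e : R 0 t p ∪ R t (t + n) p = R 0 (t + n) p := by
      ext q; simp only [mem_R, Finset.mem_union]; omega
    have e' : R 0 t p ∩ R t (t + n) p = ∅ := by
      ext q; simp [mem_R, Finset.mem_inter]; omega
    rw [e, e'] at this
    change Hh _ + Hh _ ≤ Hh _ + Hh _ at this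
    linarith
  have hmono : ∀ {a b}, a ≤ b → Hh (R 0 a p) ≤ Hh (R 0 b p) := fun {a b} hab =>
    HS_mono σ hm (by intro q; simp only [mem_R]; omega)
  have h3 : n * Hh (R 0 N p) - n * Hh (R 0 n p) ≤
      ∑ t ∈ Finset.range N, (Hh (R 0 (t + n) p) - Hh (R 0 t p)) := by
    have e3 : ∑ t ∈ Finset.range N, (Hh (R 0 (t + n) p) - Hh (R 0 t p)) =
        ∑ t ∈ Finset.range n, (Hh (R 0 (N + t) p) - Hh (R 0 t p)) := by
      simp only [Finset.sum_sub_distrib]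
      have a1 := Finset.sum_range_add (fun t => Hh (R 0 t p)) n N
      have a2 := Finset.sum_range_add (fun t => Hh (R 0 t p)) N n
      rw [add_comm N n] at a2
      have a3 : ∑ t ∈ Finset.range N, Hh (R 0 (t + n) p) = ∑ t ∈ Finset.range N, Hh (R 0 (n + t) p) :=
        Finset.sum_congr rfl fun t _ => by rw [add_comm]
      linarith
    rw [e3]
    have := Finset.card_nsmul_le_sum (Finset.range n)
      (fun t => Hh (R 0 (N + t) p) - Hh (R 0 t p)) (Hh (R 0 N p) - Hh (R 0 n p))
      (fun t ht => by
        have := hmono (show N ≤ N + t by omega)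
        have := hmono (show t ≤ n by have := Finset.mem_range.1 ht; omega)
        linarith)
    rw [Finset.card_range, nsmul_eq_mul] at this
    linarith
  have h4 := Finset.sum_le_sum fun t (_ : t ∈ Finset.range N) => h2 t
  have h5 : Hh (R 0 n p) ≤ Fintype.card ((R 0 n p) → Bool) := Ent_le_card σ _
  have h6 : (n : ℝ) * Hh (R 0 n p) ≤ n * Fintype.card ((R 0 n p) → Bool) := by gcongr
  have h7 : HS (avg σ T N) (fam T B) (R 0 n p) = Ent (avg σ T N) (nm (fam T B) (R 0 n p)) := rfl
  rw [h7]
  linarith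

lemma Ent_ge_of_atoms (σ : Measure X) [IsProbabilityMeasure σ] {α : Type*} [Fintype α]
    {f : X → α} (hf : MF f) {K : ℝ} (hK : 0 < K) (h : ∀ a, σ.real (f ⁻¹' {a}) ≤ K⁻¹) :
    Real.log K ≤ Ent σ f := by
  have e5 : ∑ a, σ.real (f ⁻¹' {a}) = 1 := by
    have := real_eq_sum σ hf Set.univ
    simp only [Set.univ_inter] at this
    rw [← this]; simp
  rw [← one_mul (Real.log K), ← e5, Finset.sum_mul]
  refine Finset.sum_le_sum fun a _ => ?_
  rcases (measureReal_nonneg (μ := σ) (s := f ⁻¹' {a})).eq_or_lt with h0 | h0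
  · rw [← h0]; simp
  · rw [Real.negMulLog, neg_mul, ← mul_neg]
    gcongr
    rw [← Real.log_inv]
    refine Real.log_le_log hK ?_
    rw [le_inv_comm₀ hK h0]; exact h a

lemma uniformOn_le [MeasurableSingletonClass X] {S : Finset X} {A : Set X}
    (h : ∀ x ∈ S, ∀ y ∈ S, x ∈ A → y ∈ A → x = y) :
    (ProbabilityTheory.uniformOn (S : Set X)).real A ≤ (S.card : ℝ)⁻¹ := by
  have hs : Set.Subsingleton ((S : Set X) ∩ A) := fun x hx y hy => h x hx.1 y hy.1 hx.2 hy.2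
  have h1 : ProbabilityTheory.uniformOn (S : Set X) A ≤ (S.card : ENNReal)⁻¹ := by
    rw [ProbabilityTheory.uniformOn, ProbabilityTheory.cond_apply S.measurableSet,
      Measure.count_apply_finset]
    rcases hs.eq_empty_or_singleton with h0 | ⟨x, h0⟩
    · rw [h0]; simp
    · rw [h0, Measure.count_singleton, mul_one]
  rcases S.eq_empty_or_nonempty with rfl | hne
  · simp [Measure.real]
  · have := ENNReal.toReal_mono (by simp [hne.ne_empty]) h1
    simpa [Measure.real] using this

end Inv

end DC2

namespace DC2

open MeasureTheory Topology

section Inv2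

variable {X : Type*} [MetricSpace X] [CompactSpace X] [MeasurableSpace X] [BorelSpace X]

lemma integral_avg (σ : Measure X) [IsProbabilityMeasure σ] {T : X → X} (hT : Continuous T)
    (N : ℕ) (f : BoundedContinuousFunction X ℝ) :
    ∫ x, f x ∂(avg σ T N) = (N : ℝ)⁻¹ * ∑ t ∈ Finset.range N, ∫ x, f (T^[t] x) ∂σ := by
  unfold avg
  rw [integral_smul_measure, integral_finsetSum_measure]
  · simp only [ENNReal.toReal_inv, ENNReal.toReal_natCast, smul_eq_mul]
    congr 1
    refine Finset.sum_congr rfl fun t _ => ?_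
    rw [integral_map (hT.iterate t).measurable.aemeasurable
      f.continuous.measurable.aestronglyMeasurable]
  · intro t _
    have : IsProbabilityMeasure (σ.map T^[t]) :=
      Measure.isProbabilityMeasure_map (hT.iterate t).measurable.aemeasurable
    exact f.integrable _

lemma integral_avg_comp (σ : Measure X) [IsProbabilityMeasure σ] {T : X → X} (hT : Continuous T)
    (N : ℕ) (f : BoundedContinuousFunction X ℝ) :
    |∫ x, f (T x) ∂(avg σ T N) - ∫ x, f x ∂(avg σ T N)| ≤ (N : ℝ)⁻¹ * (2 * ‖f‖) := by
  have h1 := integral_avg σ hT N f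
  have h2 := integral_avg σ hT N (f.compContinuous ⟨T, hT⟩)
  simp only [BoundedContinuousFunction.compContinuous_apply, ContinuousMap.coe_mk] at h2
  rw [h1, h2, ← mul_sub, ← Finset.sum_sub_distrib]
  have e : ∀ t x, f (T (T^[t] x)) = f (T^[t + 1] x) := fun t x => by
    rw [Function.iterate_succ_apply']
  simp only [e]
  rw [Finset.sum_range_sub (fun t => ∫ x, f (T^[t] x) ∂σ), abs_mul, abs_of_nonneg (by positivity)]
  gcongr
  have b : ∀ t, |∫ x, f (T^[t] x) ∂σ| ≤ ‖f‖ := by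
    intro t
    have := norm_integral_le_of_norm_le_const (μ := σ) (f := fun x => f (T^[t] x)) (C := ‖f‖)
      (Eventually.of_forall fun x => f.norm_coe_le_norm _)
    simpa using this
  have := abs_sub (∫ x, f (T^[N] x) ∂σ) (∫ x, f (T^[0] x) ∂σ)
  have := b N
  have := b 0
  linarith

lemma frontier_inter_null {μ : Measure X} {A B : Set X} (hA : μ (frontier A) = 0)
    (hB : μ (frontier B) = 0) : μ (frontier (A ∩ B)) = 0 := by
  refine measure_mono_null ((frontier_inter_subset A B).trans
    (Set.union_subset_union Set.inter_subset_left Set.inter_subset_right)) ?_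
  exact measure_union_null hA hB

lemma frontier_biInter_null {μ : Measure X} {κ : Type*} (s : Finset κ) {A : κ → Set X}
    (hA : ∀ k ∈ s, μ (frontier (A k)) = 0) : μ (frontier (⋂ k ∈ s, A k)) = 0 := by
  classical
  induction s using Finset.induction_on with
  | empty => simp
  | insert a s ha ih =>
    rw [Finset.set_biInter_insert]
    exact frontier_inter_null (hA a (Finset.mem_insert_self _ _))
      (ih fun k hk => hA k (Finset.mem_insert_of_mem hk))

lemma frontier_preimage_subset {f : X → X} (hf : Continuous f) (A : Set X) :
    frontier (f ⁻¹' A) ⊆ f ⁻¹' (frontier A) := hf.frontier_preimage_subset A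

lemma nm_frontier {μ : Measure X} {T : X → X} (hT : MeasurePreserving T μ μ) (hTc : Continuous T)
    {B : ℕ → Set X} {p : ℕ} (hB : ∀ j < p, μ (frontier (B j)) = 0) (n : ℕ)
    (a : (R 0 n p) → Bool) : μ (frontier (nm (fam T B) (R 0 n p) ⁻¹' {a})) = 0 := by
  have e : nm (fam T B) (R 0 n p) ⁻¹' {a} = ⋂ q ∈ (Finset.univ : Finset (R 0 n p)),
      {x | (x ∈ fam T B q.1 ↔ a q = true)} := by
    ext x
    simp only [Set.mem_preimage, Set.mem_singleton_iff, funext_iff, nm, Finset.mem_univ,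
      Set.iInter_true, Set.mem_iInter, Set.mem_setOf_eq]
    refine forall_congr' fun q => ?_
    cases a q <;> simp
  rw [e]
  refine frontier_biInter_null _ fun q _ => ?_
  have hq := mem_R.1 q.2
  have h0 : μ (frontier (fam T B q.1)) = 0 := by
    refine measure_mono_null (frontier_preimage_subset (hTc.iterate q.1.1) (B q.1.2)) ?_
    rw [(hT.iterate q.1.1).measure_preimage isClosed_frontier.measurableSet.nullMeasurableSet]
    exact hB _ hq.2
  cases a q with
  | true => simpa using h0
  | false =>
    have : {x | (x ∈ fam T B q.1 ↔ false = true)} = (fam T B q.1)ᶜ := by ext; simp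
    rw [this, frontier_compl]; exact h0

lemma exists_invariant (T : X → X) (hT : Continuous T)
    (hent : 0 < Dynamics.coverEntropy T (Set.univ : Set X)) :
    ∃ μ : Measure X, IsProbabilityMeasure μ ∧ MeasurePreserving T μ μ ∧ ∃ ε0 > 0, ∃ h : ℝ, 0 < h ∧
      ∀ (B : ℕ → Set X) (p : ℕ), (∀ j, MeasurableSet (B j)) → (∀ j < p, μ (frontier (B j)) = 0) →
        (∀ x, ∃ j < p, x ∈ B j) → (∀ j < p, ∀ x ∈ B j, ∀ y ∈ B j, dist x y < ε0) →
        ∀ n : ℕ, n * h ≤ HS μ (fam T B) (R 0 n p) := by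
  obtain ⟨ε0, hε0, h, hh, hfr⟩ := exists_net T hent
  obtain ⟨φ, hφ, hP⟩ := extraction_of_frequently_atTop
    (hfr.and_eventually (eventually_gt_atTop 0))
  choose hP hφ0 using hP
  choose S hS1 hS2 using hP
  have hne : ∀ k, (S k).Nonempty := fun k => by
    have : (0 : ℝ) < (S k).card := (Real.exp_pos _).trans_le (hS1 k)
    exact Finset.card_pos.1 (by exact_mod_cast this)
  set σ : ℕ → Measure X := fun k => ProbabilityTheory.uniformOn (S k : Set X) with hσ
  have hσp : ∀ k, IsProbabilityMeasure (σ k) := fun k =>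
    ProbabilityTheory.isProbabilityMeasure_uniformOn (S k).finite_toSet (hne k)
  let ms : ℕ → ProbabilityMeasure X := fun k =>
    ⟨avg (σ k) T (φ k), avg_prob (σ k) hT.measurable (hφ0 k)⟩
  obtain ⟨μ, -, hμ⟩ := isCompact_univ.ultrafilter_le_nhds ((hyperfilter ℕ).map ms) (by simp)
  have hlim : Tendsto ms (hyperfilter ℕ) (𝓝 μ) := hμ
  have hNat : Tendsto (fun k => ((φ k : ℝ))⁻¹) (hyperfilter ℕ : Filter ℕ) (𝓝 0) := by
    have h1 : Tendsto (fun k => ((φ k : ℝ))⁻¹) atTop (𝓝 0) :=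
      tendsto_inv_atTop_zero.comp (tendsto_natCast_atTop_atTop.comp hφ.tendsto_atTop)
    refine h1.mono_left ?_
    rw [← Nat.cofinite_eq_atTop]; exact hyperfilter_le_cofinite
  have hinv : MeasurePreserving T (μ : Measure X) μ := by
    refine ⟨hT.measurable, ?_⟩
    have : IsProbabilityMeasure ((μ : Measure X).map T) :=
      Measure.isProbabilityMeasure_map hT.measurable.aemeasurable
    refine ext_of_forall_integral_eq_of_IsFiniteMeasure fun f => ?_
    rw [integral_map hT.measurable.aemeasurable f.continuous.measurable.aestronglyMeasurable]
    have l1 := ProbabilityMeasure.tendsto_iff_forall_integral_tendsto.1 hlim f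
    have l2 := ProbabilityMeasure.tendsto_iff_forall_integral_tendsto.1 hlim
      (f.compContinuous ⟨T, hT⟩)
    simp only [BoundedContinuousFunction.compContinuous_apply, ContinuousMap.coe_mk] at l2
    have l3 := l2.sub l1
    have l4 : Tendsto (fun k => ∫ x, f (T x) ∂(ms k : Measure X) - ∫ x, f x ∂(ms k : Measure X))
        (hyperfilter ℕ : Filter ℕ) (𝓝 0) := by
      refine squeeze_zero_norm (a := fun k => ((φ k : ℝ))⁻¹ * (2 * ‖f‖)) (fun k => ?_) ?_
      · exact integral_avg_comp (σ k) hT (φ k) f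
      · simpa using hNat.mul_const (2 * ‖f‖)
    have := tendsto_nhds_unique l3 l4
    linarith
  refine ⟨μ, inferInstance, hinv, ε0, hε0, h, hh, ?_⟩
  intro B p hB hfront hcov hdiam n
  have hm := fam_meas hT.measurable hB
  have l1 : Tendsto (fun k => HS (ms k : Measure X) (fam T B) (R 0 n p)) (hyperfilter ℕ : Filter ℕ)
      (𝓝 (HS (μ : Measure X) (fam T B) (R 0 n p))) := by
    unfold HS Ent
    refine tendsto_finsetSum _ fun a _ => ?_
    refine (Real.continuous_negMulLog.tendsto _).comp ?_
    have h1 := ProbabilityMeasure.tendsto_measure_of_null_frontier_of_tendsto' hlim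
      (nm_frontier hinv hT hfront n a)
    exact (ENNReal.tendsto_toReal (measure_ne_top _ _)).comp h1
  have l2 : ∀ k, n * h - n * Fintype.card ((R 0 n p) → Bool) * ((φ k : ℝ))⁻¹ ≤
      HS (ms k : Measure X) (fam T B) (R 0 n p) := by
    intro k
    have hpos : (0 : ℝ) < φ k := by exact_mod_cast hφ0 k
    have a1 := HS_avg (σ k) hT.measurable (hφ0 k) hB n p
    have a2 : h * φ k ≤ HS (σ k) (fam T B) (R 0 (φ k) p) := by
      have hc : (0 : ℝ) < (S k).card := by exact_mod_cast Finset.card_pos.2 (hne k)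
      have := Ent_ge_of_atoms (σ k) (nm_MF hm (R 0 (φ k) p)) (K := (S k).card) hc (fun a => by
        refine uniformOn_le fun x hx y hy hxa hya => ?_
        by_contra hxy
        obtain ⟨i, hi, hd⟩ := hS2 k x hx y hy hxy
        obtain ⟨j, hj, hjx⟩ := hcov (T^[i] x)
        have e : nm (fam T B) (R 0 (φ k) p) x = nm (fam T B) (R 0 (φ k) p) y :=
          (show _ = a from hxa).trans (show _ = a from hya).symm
        rw [nm_eq_iff] at e
        have := (e (i, j) (by simp [mem_R, hi, hj])).1 hjx
        exact absurd (hdiam j hj _ hjx _ this) (not_lt.2 hd))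
      refine le_trans ?_ this
      rw [Real.le_log_iff_exp_le hc]; exact hS1 k
    have a3 : n * (h * φ k) ≤ n * HS (σ k) (fam T B) (R 0 (φ k) p) := by gcongr
    have a4 : n * (h * φ k) ≤ φ k * HS (ms k : Measure X) (fam T B) (R 0 n p)
      + n * Fintype.card ((R 0 n p) → Bool) := a3.trans a1
    rw [sub_le_iff_le_add]
    refine le_of_mul_le_mul_left ?_ hpos
    rw [mul_add]
    have : (φ k : ℝ) * (n * Fintype.card ((R 0 n p) → Bool) * (φ k : ℝ)⁻¹)
      = n * Fintype.card ((R 0 n p) → Bool) := by field_simp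
    rw [this]
    linarith
  have l3 : Tendsto (fun k => n * h - n * Fintype.card ((R 0 n p) → Bool) * ((φ k : ℝ))⁻¹)
      (hyperfilter ℕ : Filter ℕ) (𝓝 (n * h)) := by
    simpa using (hNat.const_mul (n * Fintype.card ((R 0 n p) → Bool) : ℝ)).const_sub (n * h)
  exact le_of_tendsto_of_tendsto' l3 l1 l2

end Inv2

end DC2

namespace DC2

open MeasureTheory Topology

section Setup

variable {X : Type*} [MetricSpace X] [CompactSpace X] [MeasurableSpace X] [BorelSpace X]

lemma exists_null_sphere (μ : Measure X) [IsProbabilityMeasure μ] (x : X) {ε : ℝ} (hε : 0 < ε) :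
    ∃ r, 0 < r ∧ r < ε ∧ μ (Metric.sphere x r) = 0 := by
  have h := Measure.countable_meas_pos_of_disjoint_iUnion (μ := μ)
    (As := fun r : ℝ => Metric.sphere x r) (fun r => Metric.isClosed_sphere.measurableSet)
    (by
      intro r r' hrr
      rw [Function.onFun, Set.disjoint_left]
      intro y hy hy'
      exact hrr ((Metric.mem_sphere.1 hy).symm.trans (Metric.mem_sphere.1 hy')))
  have h2 : ¬ (Set.Ioo (0 : ℝ) ε).Countable := by
    intro hc
    have := hc.measure_zero volume
    simp at this
    linarith
  by_contra hcon
  push Not at hcon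
  refine h2 (h.mono fun r hr => ?_)
  exact pos_iff_ne_zero.2 (hcon r hr.1 hr.2)

lemma small_collar (μ : Measure X) [IsProbabilityMeasure μ] (p : ℕ) (c : ℕ → X) (r : ℕ → ℝ)
    (hs : ∀ j < p, μ (Metric.sphere (c j) (r j)) = 0) {η : ℝ} (hη : 0 < η) :
    ∃ τ > 0, μ.real {x | ∃ j < p, |dist x (c j) - r j| ≤ τ} ≤ η := by
  let A : ℕ → Set X := fun i => {x | ∃ j < p, |dist x (c j) - r j| ≤ 1 / ((i : ℝ) + 1)}
  have hAm : ∀ i, MeasurableSet (A i) := by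
    intro i
    have : A i = ⋃ j ∈ Set.Iio p, {x | |dist x (c j) - r j| ≤ 1 / ((i : ℝ) + 1)} := by
      ext x; simp [A]
    rw [this]
    refine MeasurableSet.biUnion (Set.to_countable _) fun j _ => ?_
    exact (isClosed_le (by fun_prop) continuous_const).measurableSet
  have hanti : Antitone A := by
    intro i i' hii x hx
    obtain ⟨j, hj, hx⟩ := hx
    refine ⟨j, hj, hx.trans ?_⟩
    exact Nat.one_div_le_one_div hii
  have hI : μ (⋂ i, A i) = 0 := by
    have : (⋂ i, A i) ⊆ ⋃ j ∈ Set.Iio p, Metric.sphere (c j) (r j) := by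
      intro x hx
      by_contra hcon
      simp only [Set.mem_iUnion, Metric.mem_sphere, not_exists] at hcon
      have hpos : ∃ i : ℕ, ∀ j < p, 1 / ((i : ℝ) + 1) < |dist x (c j) - r j| := by
        have : ∀ᶠ i : ℕ in atTop, ∀ j ∈ Set.Iio p, 1 / ((i : ℝ) + 1) < |dist x (c j) - r j| := by
          rw [eventually_all_finite (Set.finite_Iio p)]
          intro j hj
          refine (tendsto_one_div_add_atTop_nhds_zero_nat (𝕜 := ℝ)).eventually (gt_mem_nhds ?_)
          exact abs_pos.2 (sub_ne_zero.2 (hcon j hj))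
        exact this.exists
      obtain ⟨i, hi⟩ := hpos
      obtain ⟨j, hj, hx⟩ := Set.mem_iInter.1 hx i
      exact absurd (hi j hj) (not_lt.2 hx)
    refine measure_mono_null this ?_
    rw [measure_biUnion_null_iff (Set.to_countable _)]
    exact hs
  have ht := tendsto_measure_iInter_atTop (μ := μ) (fun i => (hAm i).nullMeasurableSet) hanti
    ⟨0, measure_ne_top _ _⟩
  rw [hI] at ht
  have ht2 : Tendsto (fun i => μ.real (A i)) atTop (𝓝 0) := by
    have := (ENNReal.tendsto_toReal ENNReal.zero_ne_top).comp ht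
    rw [ENNReal.toReal_zero] at this
    exact this
  obtain ⟨i, hi⟩ := (ht2.eventually (gt_mem_nhds hη)).exists
  exact ⟨1 / ((i : ℝ) + 1), by positivity, hi.le⟩

lemma exists_setup (T : X → X) (hT : Continuous T)
    (hent : 0 < Dynamics.coverEntropy T (Set.univ : Set X)) :
    ∃ μ : Measure X, IsProbabilityMeasure μ ∧ MeasurePreserving T μ μ ∧ ∃ h : ℝ, 0 < h ∧
      ∃ (B : ℕ → Set X) (p : ℕ), (∀ j, MeasurableSet (B j)) ∧
        (∀ n : ℕ, n * h ≤ HS μ (fam T B) (R 0 n p)) ∧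
        (∀ ε > 0, ∃ k, ∀ x y, (∀ j < k, (x ∈ B j ↔ y ∈ B j)) → dist x y < ε) ∧
        (∀ η > 0, ∃ τ > 0, ∃ A : Set X, MeasurableSet A ∧ μ.real A ≤ η ∧
          ∀ x ∉ A, ∀ y, dist x y < τ → ∀ j < p, (x ∈ B j ↔ y ∈ B j)) := by
  obtain ⟨μ, hμ, hinv, ε0, hε0, h, hh, hmain⟩ := exists_invariant T hT hent
  have hne : Nonempty X := μ.nonempty_of_neZero
  choose rad hr1 hr2 hr3 using fun x : X => exists_null_sphere μ x (show 0 < ε0 / 2 by positivity)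
  obtain ⟨t, -, ht⟩ := isCompact_univ.elim_nhds_subcover (fun x : X => Metric.ball x (rad x))
    (fun x _ => Metric.ball_mem_nhds x (hr1 x))
  let x0 : X := Classical.arbitrary X
  let c : ℕ → X := fun j => t.toList.getD j x0
  set p := t.card with hp
  let D : ℕ → Set X := fun q =>
    Metric.ball (TopologicalSpace.denseSeq X q.unpair.1) (1 / ((q.unpair.2 : ℝ) + 1))
  let B : ℕ → Set X := fun j => if j < p then Metric.ball (c j) (rad (c j)) else D (j - p)
  have hBp : ∀ j < p, B j = Metric.ball (c j) (rad (c j)) := fun j hj => if_pos hj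
  have hBo : ∀ j, MeasurableSet (B j) := by
    intro j; simp only [B]; split_ifs <;> exact Metric.isOpen_ball.measurableSet
  refine ⟨μ, hμ, hinv, h, hh, B, p, hBo, ?_, ?_, ?_⟩
  · refine hmain B p hBo ?_ ?_ ?_
    · intro j hj
      rw [hBp j hj]
      exact measure_mono_null Metric.frontier_ball_subset_sphere (hr3 _)
    · intro x
      have := ht (Set.mem_univ x)
      simp only [Set.mem_iUnion] at this
      obtain ⟨y, hy, hxy⟩ := this
      obtain ⟨j, hj, hjy⟩ := List.getElem_of_mem (Finset.mem_toList.2 hy)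
      have hj' : j < p := by simpa [hp] using hj
      refine ⟨j, hj', ?_⟩
      rw [hBp j hj']
      have : c j = y := by simp only [c]; rw [List.getD_eq_getElem _ _ hj, hjy]
      rw [this]; exact hxy
    · intro j hj x hx y hy
      rw [hBp j hj] at hx hy
      have := dist_triangle_right x y (c j)
      have h1 := Metric.mem_ball.1 hx
      have h2 := Metric.mem_ball.1 hy
      have h3 := hr2 (c j)
      linarith
  · intro ε hε
    obtain ⟨b, hb⟩ := exists_nat_one_div_lt (show 0 < ε / 2 by positivity)
    have hcov : (Set.univ : Set X) ⊆
        ⋃ a : ℕ, Metric.ball (TopologicalSpace.denseSeq X a) (1 / ((b : ℝ) + 1)) := by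
      intro x _
      obtain ⟨a, ha⟩ := (TopologicalSpace.denseRange_denseSeq X).exists_dist_lt x
        (show 0 < 1 / ((b : ℝ) + 1) by positivity)
      exact Set.mem_iUnion.2 ⟨a, ha⟩
    obtain ⟨F, hF⟩ := isCompact_univ.elim_finite_subcover _ (fun a => Metric.isOpen_ball) hcov
    refine ⟨p + (F.sup fun a => Nat.pair a b) + 1, fun x y hxy => ?_⟩
    have := hF (Set.mem_univ x)
    simp only [Set.mem_iUnion] at this
    obtain ⟨a, ha, hxa⟩ := this
    have hle : Nat.pair a b ≤ F.sup fun a => Nat.pair a b :=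
      Finset.le_sup (f := fun a => Nat.pair a b) ha
    have hB : B (p + Nat.pair a b) = Metric.ball (TopologicalSpace.denseSeq X a)
        (1 / ((b : ℝ) + 1)) := by
      simp only [B, D]
      rw [if_neg (by omega)]
      simp
    have := hxy (p + Nat.pair a b) (by omega)
    rw [hB] at this
    have h1 := Metric.mem_ball.1 hxa
    have h2 := Metric.mem_ball.1 (this.1 hxa)
    have := dist_triangle_right x y (TopologicalSpace.denseSeq X a)
    linarith
  · intro η hη
    obtain ⟨τ, hτ, hA⟩ := small_collar μ p c (fun j => rad (c j)) (fun j _ => hr3 _) hη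
    refine ⟨τ, hτ, _, ?_, hA, ?_⟩
    · have : {x | ∃ j < p, |dist x (c j) - rad (c j)| ≤ τ}
          = ⋃ j ∈ Set.Iio p, {x | |dist x (c j) - rad (c j)| ≤ τ} := by
        ext x; simp
      rw [this]
      refine MeasurableSet.biUnion (Set.to_countable _) fun j _ => ?_
      exact (isClosed_le (by fun_prop) continuous_const).measurableSet
    · intro x hx y hxy j hj
      have hx' : τ < |dist x (c j) - rad (c j)| := by
        by_contra hcon
        exact hx ⟨j, hj, not_lt.1 hcon⟩
      rw [hBp j hj, Metric.mem_ball, Metric.mem_ball]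
      have h1 := abs_lt.1 ((abs_dist_sub_le x y (c j)).trans_lt hxy)
      rcases lt_abs.1 hx' with h2 | h2
      · constructor <;> intro <;> linarith
      · constructor <;> intro <;> linarith

end Setup

end DC2

namespace DC2

open MeasureTheory Topology

section Hahn

variable {X : Type*} [MeasurableSpace X]

lemma hahn_abstract (μ : Measure X) [IsProbabilityMeasure μ] (F : ℕ → Set X → ℝ) (C δ : ℝ)
    (hC : 0 ≤ C) (hδ : 0 < δ)
    (hadd : ∀ n A B, MeasurableSet A → MeasurableSet B → Disjoint A B →
      F n (A ∪ B) = F n A + F n B)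
    (hbd : ∀ n A, MeasurableSet A → |F n A| ≤ C * μ.real A * n + 2)
    (hpos : ∀ n : ℕ, δ * n ≤ F n Set.univ) :
    ∃ Y, MeasurableSet Y ∧ 0 < μ Y ∧ ∀ G ⊆ Y, MeasurableSet G → ∀ ε > 0,
      ∃ᶠ n : ℕ in atTop, -(ε * n) ≤ F n G := by
  classical
  set U : Ultrafilter ℕ := hyperfilter ℕ
  have hU : (U : Filter ℕ) ≤ atTop := Nat.hyperfilter_le_atTop
  have hex : ∀ A, MeasurableSet A → ∃ s : ℝ, Tendsto (fun n : ℕ => F n A / n) U (𝓝 s) := by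
    intro A hA
    have hev : ∀ᶠ n : ℕ in U, F n A / n ∈ Set.Icc (-(C + 2)) (C + 2) := by
      filter_upwards [hU (eventually_ge_atTop 1)] with n hn
      have hn' : (1 : ℝ) ≤ n := by exact_mod_cast hn
      have h1 := hbd n A hA
      have h2 : μ.real A ≤ 1 := measureReal_le_one
      rw [Set.mem_Icc, ← abs_le, abs_div, abs_of_nonneg (by positivity : (0:ℝ) ≤ n),
        div_le_iff₀ (by positivity)]
      have : C * μ.real A * n ≤ C * 1 * n := by gcongr
      nlinarith
    obtain ⟨s, -, hs⟩ := (isCompact_Icc (a := -(C + 2)) (b := C + 2)).ultrafilter_le_nhds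
      (U.map fun n : ℕ => F n A / n) (by rw [le_principal_iff]; exact hev)
    exact ⟨s, hs⟩
  choose! s hs using hex
  have hbound : ∀ A, MeasurableSet A → |s A| ≤ C * μ.real A := by
    intro A hA
    have h1 := (hs A hA).abs
    have h2 : Tendsto (fun n : ℕ => C * μ.real A + 2 / n) U (𝓝 (C * μ.real A + 0)) :=
      (tendsto_const_nhds.add (tendsto_const_div_atTop_nhds_zero_nat 2)).mono_left hU
    rw [add_zero] at h2
    refine le_of_tendsto_of_tendsto h1 h2 ?_
    filter_upwards [hU (eventually_ge_atTop 1)] with n hn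
    have hn' : (1 : ℝ) ≤ n := by exact_mod_cast hn
    rw [abs_div, abs_of_nonneg (by positivity : (0:ℝ) ≤ n), div_le_iff₀ (by positivity)]
    have h1 := hbd n A hA
    have e : (C * μ.real A + 2 / n) * n = C * μ.real A * n + 2 := by field_simp
    rw [e]; exact h1
  have hsadd : ∀ A B, MeasurableSet A → MeasurableSet B → Disjoint A B →
      s (A ∪ B) = s A + s B := by
    intro A B hA hB hAB
    refine tendsto_nhds_unique (hs _ (hA.union hB)) ?_
    have := (hs A hA).add (hs B hB)
    refine this.congr fun n => ?_
    rw [hadd n A B hA hB hAB, add_div]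
  have hs0 : s ∅ = 0 := by
    have := hbound ∅ MeasurableSet.empty
    simpa using this
  let sm : SignedMeasure X :=
    { measureOf' := fun A => if MeasurableSet A then s A else 0
      empty' := by simp [hs0]
      not_measurable' := fun A hA => by simp [hA]
      m_iUnion' := by
        intro f hf hdis
        have hfU : MeasurableSet (⋃ i, f i) := MeasurableSet.iUnion hf
        simp only [hf, hfU, if_true]
        have hμs : HasSum (fun i => μ.real (f i)) (μ.real (⋃ i, f i)) := by
          have h1 := measure_iUnion (μ := μ) hdis hf
          have h2 : ∑' i, μ (f i) ≠ ⊤ := h1 ▸ measure_ne_top _ _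
          have h3 := ENNReal.hasSum_toReal h2
          have h4 : μ.real (⋃ i, f i) = ∑' i, (μ (f i)).toReal := by
            rw [Measure.real, h1, ENNReal.tsum_toReal_eq (fun i => measure_ne_top _ _)]
          rw [h4]; exact h3
        have hsum : Summable fun i => s (f i) := by
          refine Summable.of_norm_bounded (hμs.summable.mul_left C) fun i => ?_
          exact hbound _ (hf i)
        rw [hsum.hasSum_iff_tendsto_nat]
        have hacc : ∀ n : ℕ, MeasurableSet (⋃ i ∈ Finset.range n, f i) := fun n =>
          Finset.measurableSet_biUnion _ fun i _ => hf i
        have hpart : ∀ n : ℕ, s (⋃ i ∈ Finset.range n, f i) = ∑ i ∈ Finset.range n, s (f i) ∧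
            μ.real (⋃ i ∈ Finset.range n, f i) = ∑ i ∈ Finset.range n, μ.real (f i) := by
          intro n
          induction n with
          | zero => simp [hs0]
          | succ n ih =>
            have hd : Disjoint (⋃ i ∈ Finset.range n, f i) (f n) := by
              rw [Set.disjoint_iUnion₂_left]
              intro i hi
              exact hdis (by have := Finset.mem_range.1 hi; omega)
            have e : (⋃ i ∈ Finset.range (n + 1), f i) = (⋃ i ∈ Finset.range n, f i) ∪ f n := by
              rw [Finset.range_add_one, Finset.set_biUnion_insert, Set.union_comm]
            rw [e, hsadd _ _ (hacc n) (hf n) hd, measureReal_union hd (hf n) (measure_ne_top _ _) (measure_ne_top _ _), ih.1, ih.2,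
              Finset.sum_range_succ, Finset.sum_range_succ]
            exact ⟨rfl, rfl⟩
        have hz : Tendsto (fun n => C * (μ.real (⋃ i, f i) - ∑ i ∈ Finset.range n, μ.real (f i)))
            atTop (𝓝 0) := by
          have := (tendsto_const_nhds (x := μ.real (⋃ i, f i))).sub hμs.tendsto_sum_nat
          rw [sub_self] at this
          simpa using this.const_mul C
        rw [tendsto_iff_norm_sub_tendsto_zero]
        refine squeeze_zero (fun _ => norm_nonneg _) (fun n => ?_) hz
        have hsub : (⋃ i ∈ Finset.range n, f i) ⊆ ⋃ i, f i :=
          Set.iUnion₂_subset fun i _ => Set.subset_iUnion f i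
        have h1 := hsadd _ _ (hacc n) (hfU.diff (hacc n)) Set.disjoint_sdiff_right
        rw [Set.union_sdiff_cancel hsub] at h1
        have h2 := hbound _ (hfU.diff (hacc n))
        rw [measureReal_sdiff hsub (hacc n), (hpart n).2] at h2
        rw [← (hpart n).1, Real.norm_eq_abs, abs_sub_comm, h1]
        simpa using h2 }
  have hsm : ∀ A, MeasurableSet A → sm A = s A := by
    intro A hA
    change (if MeasurableSet A then s A else 0) = s A
    simp [hA]
  obtain ⟨Y, hY, hp, hn⟩ := sm.exists_compl_positive_negative
  have hge : ∀ G ⊆ Y, MeasurableSet G → 0 ≤ s G := by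
    intro G hG hGm
    have := VectorMeasure.subset_le_of_restrict_le_restrict _ _ hY hp hG
    rw [hsm G hGm] at this
    simpa using this
  have hYc : s Yᶜ ≤ 0 := by
    have := VectorMeasure.subset_le_of_restrict_le_restrict _ _ hY.compl hn (subset_refl Yᶜ)
    rw [hsm _ hY.compl] at this
    simpa using this
  have huniv : δ ≤ s Set.univ := by
    refine ge_of_tendsto (hs _ MeasurableSet.univ) ?_
    filter_upwards [hU (eventually_ge_atTop 1)] with n hn
    have hn' : (1 : ℝ) ≤ n := by exact_mod_cast hn
    rw [le_div_iff₀ (by positivity)]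
    exact hpos n
  have hsY : δ ≤ s Y := by
    have := hsadd Y Yᶜ hY hY.compl disjoint_compl_right
    rw [Set.union_compl_self] at this
    linarith
  refine ⟨Y, hY, ?_, ?_⟩
  · rw [pos_iff_ne_zero]
    intro h0
    have h1 := hbound Y hY
    have h2 : μ.real Y = 0 := by simp [Measure.real, h0]
    rw [h2, mul_zero] at h1
    have := le_abs_self (s Y)
    linarith
  · intro G hG hGm ε hε
    have h0 := hge G hG hGm
    have h1 : ∀ᶠ n : ℕ in U, -ε < F n G / n := (hs G hGm).eventually (lt_mem_nhds (by linarith))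
    have h2 : ∃ᶠ n : ℕ in U, -(ε * n) ≤ F n G := by
      refine Eventually.frequently ?_
      filter_upwards [h1, hU (eventually_ge_atTop 1)] with n hn1 hn
      have hn' : (1 : ℝ) ≤ n := by exact_mod_cast hn
      rw [lt_div_iff₀ (by positivity)] at hn1
      linarith
    exact h2.filter_mono hU

end Hahn

section Sep

variable {X : Type*}

lemma sep_or_cover (sep : X → X → Prop) (hsymm : ∀ x y, sep x y → sep y x) (hirr : ∀ x, ¬ sep x x)
    (G : Set X) (k : ℕ) :
    (∃ S : Finset X, (S : Set X) ⊆ G ∧ S.card = k ∧ ∀ x ∈ S, ∀ y ∈ S, x ≠ y → sep x y) ∨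
    (∃ S : Finset X, (S : Set X) ⊆ G ∧ S.card ≤ k ∧ ∀ y ∈ G, ∃ x ∈ S, ¬ sep x y) := by
  classical
  induction k with
  | zero => exact Or.inl ⟨∅, by simp⟩
  | succ k ih =>
    rcases ih with ⟨S, hS, hc, hs⟩ | ⟨S, hS, hc, hs⟩
    · by_cases h : ∃ y ∈ G, ∀ x ∈ S, sep x y
      · obtain ⟨y, hy, hsy⟩ := h
        have hyS : y ∉ S := fun h => hirr y (hsy y h)
        refine Or.inl ⟨insert y S, ?_, ?_, ?_⟩
        · intro z hz
          rcases Finset.mem_insert.1 (Finset.mem_coe.1 hz) with rfl | hz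
          · exact hy
          · exact hS hz
        · rw [Finset.card_insert_of_notMem hyS, hc]
        · intro x hx z hz hxz
          rcases Finset.mem_insert.1 hx with rfl | hx' <;>
            rcases Finset.mem_insert.1 hz with rfl | hz'
          · exact absurd rfl hxz
          · exact hsymm _ _ (hsy z hz')
          · exact hsy x hx'
          · exact hs x hx' z hz' hxz
      · push Not at h
        exact Or.inr ⟨S, hS, by omega, h⟩
    · exact Or.inr ⟨S, hS, by omega, hs⟩

end Sep

end DC2

set_option linter.unusedSectionVars false

namespace DC2

open MeasureTheory Topology

section Core

open Classical in
/-- Itinerary words. -/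
noncomputable def wd {X : Type*} (T : X → X) (B : ℕ → Set X) (n p : ℕ) (x : X) :
    Fin n → (Fin p → Bool) := fun i j => decide (T^[i] x ∈ B j)

/-- Number of separated times. -/
noncomputable def sepc {X : Type*} [MetricSpace X] (T : X → X) (τ : ℝ) (n : ℕ) (x y : X) : ℕ :=
  ((Finset.range n).filter fun i => τ ≤ dist (T^[i] x) (T^[i] y)).card

open Classical in
/-- Number of visits. -/
noncomputable def vis {X : Type*} (T : X → X) (A : Set X) (n : ℕ) (x : X) : ℕ :=
  ((Finset.range n).filter fun i => T^[i] x ∈ A).card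

/-- Information carried by a set. -/
noncomputable def IF {X : Type*} [MeasurableSpace X] (μ : Measure X) {α : Type*} [Fintype α]
    (w : X → α) (G : Set X) : ℝ :=
  ∑ a, μ.real (G ∩ w ⁻¹' {a}) * (-Real.log (μ.real (w ⁻¹' {a})))

variable {X : Type*} [MetricSpace X] [MeasurableSpace X]

lemma sepc_symm (T : X → X) (τ : ℝ) (n : ℕ) (x y : X) : sepc T τ n x y = sepc T τ n y x := by
  unfold sepc
  simp only [dist_comm]

lemma sepc_self (T : X → X) {τ : ℝ} (hτ : 0 < τ) (n : ℕ) (x : X) : sepc T τ n x x = 0 := by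
  unfold sepc
  simp [hτ]

lemma IF_add (μ : Measure X) [IsProbabilityMeasure μ] {α : Type*} [Fintype α] {w : X → α}
    (hw : MF w) {G G' : Set X} (hG' : MeasurableSet G') (hd : Disjoint G G') :
    IF μ w (G ∪ G') = IF μ w G + IF μ w G' := by
  unfold IF
  rw [← Finset.sum_add_distrib]
  refine Finset.sum_congr rfl fun a _ => ?_
  rw [Set.union_inter_distrib_right, measureReal_union (hd.mono Set.inter_subset_left
    Set.inter_subset_left) (hG'.inter (hw a)) (measure_ne_top _ _) (measure_ne_top _ _), add_mul]

lemma IF_nonneg (μ : Measure X) [IsProbabilityMeasure μ] {α : Type*} [Fintype α] (w : X → α)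
    (G : Set X) : 0 ≤ IF μ w G := by
  refine Finset.sum_nonneg fun a _ => mul_nonneg measureReal_nonneg ?_
  rw [neg_nonneg]
  exact Real.log_nonpos measureReal_nonneg measureReal_le_one

lemma IF_univ (μ : Measure X) [IsProbabilityMeasure μ] {α : Type*} [Fintype α] (w : X → α) :
    IF μ w Set.univ = Ent μ w := by
  unfold IF Ent
  refine Finset.sum_congr rfl fun a _ => ?_
  rw [Set.univ_inter, Real.negMulLog]; ring

lemma wd_MF {T : X → X} (hT : Measurable T) {B : ℕ → Set X} (hB : ∀ j, MeasurableSet (B j))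
    (n p : ℕ) : MF (wd T B n p) := by
  refine MF.pi fun i => MF.pi fun j => ?_
  intro b
  have h : MeasurableSet {x | T^[i] x ∈ B j} := (hT.iterate i) (hB j)
  cases b
  · convert h.compl using 1
    ext x; simp [wd]
  · convert h using 1
    ext x; simp [wd]

lemma wd_eq_iff (T : X → X) (B : ℕ → Set X) (n p : ℕ) (x y : X) :
    wd T B n p x = wd T B n p y ↔ nm (fam T B) (R 0 n p) x = nm (fam T B) (R 0 n p) y := by
  rw [nm_eq_iff]
  constructor
  · intro h q hq
    rw [mem_R] at hq
    have := congrFun (congrFun h ⟨q.1, hq.1.2⟩) ⟨q.2, hq.2⟩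
    simpa [wd, mem_fam] using this
  · intro h
    funext i j
    have := h (i, j) (by rw [mem_R]; exact ⟨⟨Nat.zero_le _, i.2⟩, j.2⟩)
    simpa [wd, mem_fam] using this

lemma ham_le (T : X → X) (B : ℕ → Set X) (n p : ℕ) {τ : ℝ} {A : Set X}
    (hA : ∀ x ∉ A, ∀ y, dist x y < τ → ∀ j < p, (x ∈ B j ↔ y ∈ B j)) (x y : X) :
    hammingDist (wd T B n p y) (wd T B n p x) ≤ sepc T τ n x y + vis T A n x := by
  classical
  unfold hammingDist sepc vis
  refine le_trans ?_ (Finset.card_union_le _ _)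
  rw [← Finset.card_image_of_injective _ Fin.val_injective]
  refine Finset.card_le_card ?_
  intro i hi
  obtain ⟨i, hi2, rfl⟩ := Finset.mem_image.1 hi
  have hi := (Finset.mem_filter.1 hi2).2
  simp only [Finset.mem_union, Finset.mem_filter, Finset.mem_range]
  by_contra hcon
  push Not at hcon
  refine hi ?_
  funext j
  have := hA _ (hcon.2 i.2) _ (hcon.1 i.2) j j.2
  simp [wd, this]

lemma vis_markov (μ : Measure X) [IsProbabilityMeasure μ] {T : X → X} (hT : Measurable T)
    {A : Set X} (hA : MeasurableSet A) (n : ℕ) {H : Set X} (hH : MeasurableSet H) {r : ℝ}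
    (hr : ∀ x ∈ H, r ≤ vis T A n x) :
    r * μ.real H ≤ ∑ i ∈ Finset.range n, μ.real (H ∩ T^[i] ⁻¹' A) := by
  classical
  have hm : ∀ i, MeasurableSet (T^[i] ⁻¹' A) := fun i => (hT.iterate i) hA
  have h1 : ∀ x, (vis T A n x : ℝ) = ∑ i ∈ Finset.range n, (T^[i] ⁻¹' A).indicator 1 x := by
    intro x
    unfold vis
    rw [Finset.card_filter]
    push_cast
    refine Finset.sum_congr rfl fun i _ => ?_
    simp [Set.indicator_apply]
  have hintg : ∀ i, Integrable ((T^[i] ⁻¹' A).indicator (1 : X → ℝ)) (μ.restrict H) := fun i =>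
    (integrable_const (1 : ℝ)).indicator (hm i)
  have h2 : ∫ x in H, (vis T A n x : ℝ) ∂μ = ∑ i ∈ Finset.range n, μ.real (H ∩ T^[i] ⁻¹' A) := by
    simp only [h1]
    rw [integral_finsetSum _ fun i _ => hintg i]
    refine Finset.sum_congr rfl fun i _ => ?_
    rw [integral_indicator_one (hm i), measureReal_restrict_apply (hm i), Set.inter_comm]
  have hi : Integrable (fun x => (vis T A n x : ℝ)) (μ.restrict H) := by
    simp only [h1]
    exact integrable_finsetSum _ fun i _ => hintg i
  rw [← h2]
  have h3 : ∫ x in H, r ∂μ = r * μ.real H := by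
    rw [setIntegral_const, smul_eq_mul, mul_comm]
  rw [← h3]
  exact setIntegral_mono_on (integrable_const _) hi hH hr

lemma vis_meas {T : X → X} (hT : Measurable T) {A : Set X} (hA : MeasurableSet A) (n : ℕ) (r : ℝ) :
    MeasurableSet {x | (vis T A n x : ℝ) ≤ r} := by
  classical
  have h1 : ∀ x, (vis T A n x : ℝ) = ∑ i ∈ Finset.range n, (T^[i] ⁻¹' A).indicator 1 x := by
    intro x
    unfold vis
    rw [Finset.card_filter]
    push_cast
    refine Finset.sum_congr rfl fun i _ => ?_
    simp [Set.indicator_apply]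
  simp only [h1]
  refine measurableSet_le ?_ measurable_const
  refine Finset.measurable_sum _ fun i _ => ?_
  exact measurable_one.indicator ((hT.iterate i) hA)

/-- Bound on the number of words in a fibre that has no large separated family. -/
lemma bad_count (T : X → X) (B : ℕ → Set X) (n p : ℕ) {τ ρ l : ℝ} {A : Set X}
    (hl : 0 < l) (hl1 : l ≤ 1)
    (hA : ∀ x ∉ A, ∀ y, dist x y < τ → ∀ j < p, (x ∈ B j ↔ y ∈ B j))
    {G : Set X} (hG : ∀ x ∈ G, (vis T A n x : ℝ) ≤ ρ * n) (L : ℕ)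
    (S : Finset X) (hS : (S : Set X) ⊆ G) (hc : S.card ≤ L)
    (hcov : ∀ y ∈ G, ∃ x ∈ S, ¬ (ρ * n ≤ sepc T τ n x y))
    (W : Finset (Fin n → (Fin p → Bool))) (hW : ∀ a ∈ W, ∃ y ∈ G, wd T B n p y = a) :
    (W.card : ℝ) ≤ L * ((l⁻¹) ^ (⌊2 * ρ * n⌋₊) *
      (1 + Fintype.card (Fin p → Bool) * l) ^ n) := by
  classical
  have hsub : W ⊆ S.biUnion fun x => Finset.univ.filter
      fun w : Fin n → (Fin p → Bool) => hammingDist w (wd T B n p x) ≤ ⌊2 * ρ * n⌋₊ := by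
    intro a ha
    obtain ⟨y, hy, rfl⟩ := hW a ha
    obtain ⟨x, hx, hxy⟩ := hcov y hy
    refine Finset.mem_biUnion.2 ⟨x, hx, Finset.mem_filter.2 ⟨Finset.mem_univ _, ?_⟩⟩
    refine Nat.le_floor ?_
    have h1 : (hammingDist (wd T B n p y) (wd T B n p x) : ℝ) ≤ sepc T τ n x y + vis T A n x := by
      exact_mod_cast ham_le T B n p hA x y
    have h2 := hG x (hS hx)
    push Not at hxy
    linarith
  have h1 : (W.card : ℝ) ≤ ∑ x ∈ S, ((Finset.univ.filter fun w : Fin n → (Fin p → Bool) =>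
      hammingDist w (wd T B n p x) ≤ ⌊2 * ρ * n⌋₊).card : ℝ) := by
    exact_mod_cast (Finset.card_le_card hsub).trans Finset.card_biUnion_le
  refine h1.trans ((Finset.sum_le_sum fun x _ => hamming_count n _ _ hl hl1).trans ?_)
  rw [Finset.sum_const, nsmul_eq_mul]
  have : (S.card : ℝ) ≤ L := by exact_mod_cast hc
  gcongr

lemma log_V_le {ρ l a : ℝ} (hρ : 0 ≤ ρ) (hl : 0 < l) (hl1 : l ≤ 1) (ha : 0 ≤ a) (n : ℕ) :
    Real.log ((l⁻¹) ^ (⌊2 * ρ * n⌋₊) * (1 + a * l) ^ n) ≤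
      (2 * ρ * Real.log (l⁻¹) + a * l) * n := by
  have h1 : 0 < 1 + a * l := by positivity
  rw [Real.log_mul (by positivity) (by positivity), Real.log_pow, Real.log_pow]
  have h2 : Real.log (1 + a * l) ≤ a * l := by
    have := Real.log_le_sub_one_of_pos h1
    linarith
  have h3 : 0 ≤ Real.log (l⁻¹) := Real.log_nonneg ((one_le_inv₀ hl).2 hl1)
  have h4 : ((⌊2 * ρ * n⌋₊ : ℕ) : ℝ) ≤ 2 * ρ * n := Nat.floor_le (by positivity)
  have h5 := mul_le_mul_of_nonneg_right h4 h3
  have h6 : (n : ℝ) * Real.log (1 + a * l) ≤ n * (a * l) := by gcongr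
  linarith

lemma core_step (μ : Measure X) [IsProbabilityMeasure μ] {T : X → X} (hT : Measurable T)
    {B : ℕ → Set X} (hB : ∀ j, MeasurableSet (B j)) (n p : ℕ) (hn : 1 ≤ n) {τ ρ l : ℝ} {A : Set X}
    (hτ : 0 < τ) (hρ : 0 < ρ) (hl : 0 < l) (hl1 : l ≤ 1)
    (hA : ∀ x ∉ A, ∀ y, dist x y < τ → ∀ j < p, (x ∈ B j ↔ y ∈ B j))
    {G : Set X} (hGm : MeasurableSet G) (hG : ∀ x ∈ G, (vis T A n x : ℝ) ≤ ρ * n)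
    (ι : Type) [Fintype ι] {β : Type*} [Fintype β] {f : X → β} (hf : MF f) :
    ∃ S ⊆ G, MeasurableSet S ∧
      (∀ z ∈ S, ∃ y : ι → X, (∀ i, y i ∈ G) ∧ (∀ i, f (y i) = f z) ∧
        ∀ i j, i ≠ j → ρ * n ≤ sepc T τ n (y i) (y j)) ∧
      IF μ (wd T B n p) G ≤ μ.real S * (n * Real.log (Fintype.card (Fin p → Bool))) +
        μ.real G * (Real.log (Fintype.card ι + 1) +
          (2 * ρ * Real.log (l⁻¹) + Fintype.card (Fin p → Bool) * l) * n) +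
        (Ent μ (wd T B n p) + Ent μ f - Ent μ (fun x => (wd T B n p x, f x))) + 2 := by
  classical
  have hn' : (1 : ℝ) ≤ n := by exact_mod_cast hn
  set V : ℝ := (l⁻¹) ^ (⌊2 * ρ * n⌋₊) * (1 + Fintype.card (Fin p → Bool) * l) ^ n with hV
  have hV1 : 1 ≤ V := by
    refine one_le_mul_of_one_le_of_one_le (one_le_pow₀ ((one_le_inv₀ hl).2 hl1)) (one_le_pow₀ ?_)
    have : (0 : ℝ) ≤ Fintype.card (Fin p → Bool) * l := by positivity
    linarith
  let good : β → Prop := fun b => ∃ y : ι → X, (∀ i, y i ∈ G) ∧ (∀ i, f (y i) = b) ∧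
        ∀ i j, i ≠ j → ρ * n ≤ sepc T τ n (y i) (y j)
  let K : β → ℝ := fun b => if good b then ((Fintype.card (Fin p → Bool) : ℝ)) ^ n
    else (Fintype.card ι + 1) * V
  have hK1 : ∀ b, 1 ≤ K b := by
    intro b
    by_cases hb : good b
    · simp only [K, hb, if_true]
      exact one_le_pow₀ (by exact_mod_cast Fintype.card_pos)
    · simp only [K, hb, if_false]
      refine one_le_mul_of_one_le_of_one_le ?_ hV1
      have : (0 : ℝ) ≤ Fintype.card ι := by positivity
      linarith
  have hK : ∀ b, ((Finset.univ.filter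
      fun a => 0 < μ.real (G ∩ wd T B n p ⁻¹' {a} ∩ f ⁻¹' {b})).card : ℝ) ≤ K b := by
    intro b
    by_cases hb : good b
    · simp only [K, hb, if_true]
      have := Finset.card_le_univ (Finset.univ.filter
        fun a => 0 < μ.real (G ∩ wd T B n p ⁻¹' {a} ∩ f ⁻¹' {b}))
      rw [Fintype.card_fun, Fintype.card_fin] at this
      exact_mod_cast this
    · simp only [K, hb, if_false]
      have hW : ∀ a ∈ Finset.univ.filter
          (fun a => 0 < μ.real (G ∩ wd T B n p ⁻¹' {a} ∩ f ⁻¹' {b})),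
          ∃ y ∈ G ∩ f ⁻¹' {b}, wd T B n p y = a := by
        intro a ha
        have ha := (Finset.mem_filter.1 ha).2
        have hne : (G ∩ wd T B n p ⁻¹' {a} ∩ f ⁻¹' {b}).Nonempty := by
          by_contra h
          rw [Set.not_nonempty_iff_eq_empty.1 h] at ha
          simp at ha
        obtain ⟨y, ⟨hy1, hy2⟩, hy3⟩ := hne
        exact ⟨y, ⟨hy1, hy3⟩, hy2⟩
      rcases sep_or_cover (fun x y => ρ * n ≤ sepc T τ n x y)
        (fun x y h => by rw [sepc_symm]; exact h)
        (fun x => by rw [sepc_self T hτ]; push_cast; rw [not_le]; positivity)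
        (G ∩ f ⁻¹' {b}) (Fintype.card ι) with ⟨S, hS, hc, hs⟩ | ⟨S, hS, hc, hs⟩
      · exfalso
        apply hb
        have e : ι ≃ S := Fintype.equivOfCardEq (by rw [Fintype.card_coe, hc])
        refine ⟨fun i => (e i : X), fun i => (hS (e i).2).1, fun i => (hS (e i).2).2, ?_⟩
        intro i j hij
        refine hs _ (e i).2 _ (e j).2 ?_
        intro h
        exact hij (e.injective (Subtype.ext h))
      · have := bad_count T B n p hl hl1 hA (G := G ∩ f ⁻¹' {b}) (fun x hx => hG x hx.1)
          (Fintype.card ι) S hS hc hs _ hW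
        refine this.trans ?_
        gcongr
        linarith
  have hkey := key_ineq μ (wd_MF hT hB n p) hf (G := G) K hK1 hK
  set S : Set X := G ∩ ⋃ b ∈ Finset.univ.filter good, f ⁻¹' {b} with hSdef
  have hSm : MeasurableSet S := hGm.inter (Finset.measurableSet_biUnion _ fun b _ => hf b)
  have hS : ∀ x, x ∈ S ↔ x ∈ G ∧ good (f x) := by
    intro x; simp [hSdef]
  refine ⟨S, Set.inter_subset_left, hSm, ?_, ?_⟩
  · intro z hz
    exact ((hS z).1 hz).2
  · unfold IF
    refine hkey.trans ?_
    have hlogK : Real.log ((Fintype.card ι + 1) * V) ≤ Real.log (Fintype.card ι + 1) +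
          (2 * ρ * Real.log (l⁻¹) + Fintype.card (Fin p → Bool) * l) * n := by
      rw [Real.log_mul (by positivity) (by positivity)]
      gcongr
      exact log_V_le hρ.le hl hl1 (by positivity) n
    have hlog0 : 0 ≤ Real.log ((Fintype.card ι + 1) * V) := by
      refine Real.log_nonneg (one_le_mul_of_one_le_of_one_le ?_ hV1)
      have : (0 : ℝ) ≤ Fintype.card ι := by positivity
      linarith
    have hsum : ∑ b, μ.real (G ∩ f ⁻¹' {b}) * Real.log (K b) ≤
        μ.real S * (n * Real.log (Fintype.card (Fin p → Bool))) +
        μ.real G * Real.log ((Fintype.card ι + 1) * V) := by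
      rw [real_eq_sum μ hf S, real_eq_sum μ hf G, Finset.sum_mul, Finset.sum_mul,
        ← Finset.sum_add_distrib]
      refine Finset.sum_le_sum fun b _ => ?_
      have hn0 : (0 : ℝ) ≤ n * Real.log (Fintype.card (Fin p → Bool)) :=
        mul_nonneg (by positivity) (Real.log_nonneg (by exact_mod_cast Fintype.card_pos))
      by_cases hb : good b
      · have e : S ∩ f ⁻¹' {b} = G ∩ f ⁻¹' {b} := by
          ext x
          simp only [Set.mem_inter_iff, hS, Set.mem_preimage, Set.mem_singleton_iff]
          constructor
          · rintro ⟨⟨h1, -⟩, h2⟩; exact ⟨h1, h2⟩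
          · rintro ⟨h1, h2⟩; exact ⟨⟨h1, h2 ▸ hb⟩, h2⟩
        rw [e]
        simp only [K, hb, if_true, Real.log_pow]
        have : 0 ≤ μ.real (G ∩ f ⁻¹' {b}) * Real.log ((Fintype.card ι + 1) * V) :=
          mul_nonneg measureReal_nonneg hlog0
        linarith
      · simp only [K, hb, if_false]
        have : 0 ≤ μ.real (S ∩ f ⁻¹' {b}) * (n * Real.log (Fintype.card (Fin p → Bool))) :=
          mul_nonneg measureReal_nonneg hn0
        linarith
    have := mul_le_mul_of_nonneg_left hlogK (measureReal_nonneg (μ := μ) (s := G))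
    linarith

end Core

end DC2

set_option linter.unusedSectionVars false

namespace DC2

open MeasureTheory Topology

section ClaimC

/-- Equality of slow names on a window of times. -/
def Eqv {X : Type*} (T : X → X) (B : ℕ → Set X) (m : ℕ → ℕ) (a b : ℕ) (x y : X) : Prop :=
  ∀ i, a ≤ i → i < b → ∀ j < m i, (T^[i] x ∈ B j ↔ T^[i] y ∈ B j)

variable {X : Type*} [MetricSpace X] [CompactSpace X] [MeasurableSpace X] [BorelSpace X]

lemma HS_ShSub {μ : Measure X} [IsProbabilityMeasure μ] {T : X → X} (hT : MeasurePreserving T μ μ)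
    {B : ℕ → Set X} (hB : ∀ j, MeasurableSet (B j)) : ShSub (HS μ (fam T B)) where
  mono := fun h => HS_mono μ (fam_meas hT.measurable hB) h
  submod := HS_submod μ (fam_meas hT.measurable hB)
  shift := HS_shift hT hB
  empty := HS_empty μ _

lemma Eqv_of_nm {T : X → X} {B : ℕ → Set X} {m : ℕ → ℕ} {n N : ℕ} {x y : X}
    (h : nm (fam T B) (Zs m n N) x = nm (fam T B) (Zs m n N) y) : Eqv T B m n N x y := by
  rw [nm_eq_iff] at h
  intro i h1 h2 j hj
  exact h (i, j) (by rw [mem_Zs]; exact ⟨⟨h1, h2⟩, hj⟩)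

lemma wd_info {μ : Measure X} [IsProbabilityMeasure μ] {T : X → X} (hT : MeasurePreserving T μ μ)
    {B : ℕ → Set X} (hB : ∀ j, MeasurableSet (B j)) {p k0 : ℕ} (hp : p ≤ k0) (n : ℕ)
    (Z : Finset (ℕ × ℕ)) :
    Ent μ (wd T B n p) + Ent μ (nm (fam T B) Z) - Ent μ (fun x => (wd T B n p x, nm (fam T B) Z x))
      ≤ HS μ (fam T B) (R 0 n k0) + HS μ (fam T B) Z - HS μ (fam T B) (R 0 n k0 ∪ Z) := by
  have hm := fam_meas hT.measurable hB
  have hw := wd_MF hT.measurable hB n p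
  have e1 : Ent μ (wd T B n p) = HS μ (fam T B) (R 0 n p) :=
    Ent_eq_of_factor μ hw (nm_MF hm _) fun x y => (wd_eq_iff T B n p x y).symm
  have e2 : Ent μ (fun x => (wd T B n p x, nm (fam T B) Z x)) = HS μ (fam T B) (R 0 n p ∪ Z) := by
    refine Ent_eq_of_factor μ (hw.prodMk (nm_MF hm Z)) (nm_MF hm _) fun x y => ?_
    rw [Prod.mk.injEq, wd_eq_iff, nm_eq_iff, nm_eq_iff, nm_eq_iff]
    simp only [Finset.mem_union, or_imp, forall_and]
  rw [e1, e2]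
  exact (HS_ShSub hT hB).info_mono (by intro q; simp only [mem_R]; omega) (subset_refl Z)

set_option maxHeartbeats 1000000 in
lemma claim_c (T : X → X) (hT : Continuous T)
    (hent : 0 < Dynamics.coverEntropy T (Set.univ : Set X)) :
    ∃ (μ : Measure X) (_ : IsProbabilityMeasure μ) (B : ℕ → Set X) (m : ℕ → ℕ) (τ ρ : ℝ)
      (Y : Set X), (∀ j, MeasurableSet (B j)) ∧ Monotone m ∧ Tendsto m atTop atTop ∧
      (∀ ε > 0, ∃ k : ℕ, ∀ x y, (∀ j < k, (x ∈ B j ↔ y ∈ B j)) → dist x y < ε) ∧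
      0 < τ ∧ 0 < ρ ∧ (∀ i x y, (∀ j < m i, (x ∈ B j ↔ y ∈ B j)) → dist x y < τ / 3) ∧
      MeasurableSet Y ∧ 0 < μ Y ∧ ∀ G ⊆ Y, MeasurableSet G → 0 < μ G →
      ∀ (ι : Type) [Fintype ι] (n0 : ℕ), ∃ n ≥ n0, ∃ η > 0, ∀ N, ∃ S ⊆ G, MeasurableSet S ∧
        η ≤ μ.real S ∧ ∀ z ∈ S, ∃ y : ι → X, (∀ l, y l ∈ G) ∧ (∀ l, Eqv T B m n N (y l) z) ∧
          ∀ l l', l ≠ l' → ρ * n ≤ sepc T τ n (y l) (y l') := by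
  obtain ⟨μ, hμ, hTm, h, hh, B, p, hB, hHS, hfine, hcol⟩ := exists_setup T hT hent
  have hTme := hTm.measurable
  set a : ℝ := (Fintype.card (Fin p → Bool) : ℝ) with ha
  have ha1 : 1 ≤ a := by
    rw [ha]; exact_mod_cast Fintype.card_pos
  set La : ℝ := Real.log a with hLa
  have hLa0 : 0 ≤ La := Real.log_nonneg ha1
  set c : ℝ := h / 4 with hc
  have hc0 : 0 < c := by positivity
  set l : ℝ := min 1 (c / (16 * a)) with hl
  have hl0 : 0 < l := lt_min one_pos (by positivity)
  have hl1 : l ≤ 1 := min_le_left _ _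
  have hal : a * l ≤ c / 16 := by
    calc a * l ≤ a * (c / (16 * a)) := by gcongr; exact min_le_right _ _
      _ = c / 16 := by field_simp
  have hll : 0 ≤ Real.log (l⁻¹) := Real.log_nonneg ((one_le_inv₀ hl0).2 hl1)
  set ρ : ℝ := c / (32 * (Real.log (l⁻¹) + 1)) with hρ
  have hρ0 : 0 < ρ := by positivity
  have hρl : 2 * ρ * Real.log (l⁻¹) ≤ c / 16 := by
    have : 2 * ρ * (Real.log (l⁻¹) + 1) = c / 16 := by 
      have h1 : Real.log (l⁻¹) + 1 ≠ 0 := by positivity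
      rw [hρ]
      generalize Real.log (l⁻¹) + 1 = u at h1
      field_simp
      norm_num
    nlinarith
  set C : ℝ := La / ρ with hC
  have hC0 : 0 ≤ C := by positivity
  have hCρ : C * ρ = La := by rw [hC]; field_simp
  obtain ⟨τ, hτ, A, hAm, hAμ, hAc⟩ := hcol (h / (4 * (C + 1))) (by positivity)
  have hCA : C * μ.real A ≤ h / 4 := by
    calc C * μ.real A ≤ (C + 1) * (h / (4 * (C + 1))) := by gcongr; linarith
      _ = h / 4 := by field_simp
  obtain ⟨k1, hk1⟩ := hfine (τ / 3) (by positivity)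
  set k0 := max p k1
  obtain ⟨m, hmono, hmt, hmk, δ, hδ, hslow⟩ := (HS_ShSub hTm hB).slow k0
  have hTi : ∀ i, MeasurableSet (T^[i] ⁻¹' A) := fun i => (hTme.iterate i) hAm
  have hw := fun n => wd_MF hTme hB n p
  have hIF : ∀ n G, IF μ (wd T B n p) G ≤ μ.real G * (n * La) + 2 := by
    intro n G
    have := simple_bound μ (hw n) G
    rw [Fintype.card_fun, Fintype.card_fin, Nat.cast_pow, Real.log_pow] at this
    exact this
  let V : ℕ → Set X → ℝ := fun n G => ∑ i ∈ Finset.range n, μ.real (G ∩ T^[i] ⁻¹' A)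
  have hV0 : ∀ n G, 0 ≤ V n G := fun n G => Finset.sum_nonneg fun i _ => measureReal_nonneg
  have hVle : ∀ n G, V n G ≤ n * μ.real G := by
    intro n G
    calc V n G ≤ ∑ i ∈ Finset.range n, μ.real G :=
          Finset.sum_le_sum fun i _ => measureReal_mono Set.inter_subset_left (measure_ne_top _ _)
      _ = n * μ.real G := by simp
  obtain ⟨Y, hY, hY0, hYG⟩ := hahn_abstract μ
    (fun n G => IF μ (wd T B n p) G - C * V n G - c * n * μ.real G) (La + C + c) (h / 4)
    (by positivity) (by positivity)
    (by
      intro n G G' hG hG' hd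
      have h1 : V n (G ∪ G') = V n G + V n G' := by
        simp only [V]
        rw [← Finset.sum_add_distrib]
        refine Finset.sum_congr rfl fun i _ => ?_
        rw [Set.union_inter_distrib_right, measureReal_union (hd.mono Set.inter_subset_left
          Set.inter_subset_left) (hG'.inter (hTi i)) (measure_ne_top _ _) (measure_ne_top _ _)]
      rw [IF_add μ (hw n) hG' hd, h1, measureReal_union hd hG' (measure_ne_top _ _)
        (measure_ne_top _ _)]
      ring)
    (by
      intro n G hG
      have h1 := hIF n G
      have h2 := IF_nonneg μ (wd T B n p) G
      have h3 := mul_nonneg hC0 (hV0 n G)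
      have h4 := mul_le_mul_of_nonneg_left (hVle n G) hC0
      have h5 : 0 ≤ c * n * μ.real G := by positivity
      have h6 : 0 ≤ μ.real G * (n * La) := by positivity
      rw [abs_le]
      constructor <;> nlinarith)
    (by
      intro n
      have h1 : n * h ≤ IF μ (wd T B n p) Set.univ := by
        rw [IF_univ]
        refine (hHS n).trans (le_of_eq ?_)
        exact (Ent_eq_of_factor μ (hw n) (nm_MF (fam_meas hTme hB) _)
          fun x y => (wd_eq_iff T B n p x y).symm).symm
      have h2 : V n Set.univ = n * μ.real A := by
        simp only [V]
        have : ∀ i, μ.real (Set.univ ∩ T^[i] ⁻¹' A) = μ.real A := by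
          intro i
          rw [Set.univ_inter, (hTm.iterate i).measureReal_preimage hAm.nullMeasurableSet]
        rw [Finset.sum_congr rfl fun i _ => this i]
        simp
      have h3 : C * (n * μ.real A) ≤ n * (h / 4) := by
        have := mul_le_mul_of_nonneg_left hCA (Nat.cast_nonneg (α := ℝ) n)
        linarith
      have h0 : 0 ≤ n * h := by positivity
      simp only [h2, probReal_univ, hc]
      linarith)
  refine ⟨μ, hμ, B, m, τ, ρ, Y, hB, hmono, hmt, hfine, hτ, hρ0, ?_, hY, hY0, ?_⟩
  · intro i x y hxy
    exact hk1 x y fun j hj => hxy j (lt_of_lt_of_le hj ((le_max_right _ _).trans (hmk i)))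
  intro G hGY hGm hG0 ι _ n0
  set β : ℝ := μ.real G with hβ
  have hβ0 : 0 < β := ENNReal.toReal_pos hG0.ne' (measure_ne_top _ _)
  have hβ1 : β ≤ 1 := measureReal_le_one
  have hLn : 0 ≤ Real.log (Fintype.card ι + 1) := Real.log_nonneg (by
    have : (0 : ℝ) ≤ Fintype.card ι := by positivity
    linarith)
  have hev1 : ∀ᶠ n : ℕ in atTop, δ n < c * β / 8 := hδ.eventually (gt_mem_nhds (by positivity))
  have hev2 : ∀ᶠ n : ℕ in atTop, 6 + Real.log (Fintype.card ι + 1) ≤ c * β / 8 * n := by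
    have : Tendsto (fun n : ℕ => c * β / 8 * (n : ℝ)) atTop atTop :=
      tendsto_natCast_atTop_atTop.const_mul_atTop (by positivity)
    exact this.eventually_ge_atTop _
  obtain ⟨n, hFn, hδn, hn2, hn⟩ := ((hYG G hGY hGm (c * β / 8) (by positivity)).and_eventually
    (hev1.and (hev2.and (eventually_ge_atTop (max n0 1))))).exists
  have hn0 : n0 ≤ n := (le_max_left _ _).trans hn
  have hn1 : 1 ≤ n := (le_max_right _ _).trans hn
  have hn' : (1 : ℝ) ≤ n := by exact_mod_cast hn1
  refine ⟨n, hn0, c * β / (4 * (La + 1)), by positivity, fun N => ?_⟩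
  set G1 : Set X := G ∩ {x | (vis T A n x : ℝ) ≤ ρ * n} with hG1
  have hG1m : MeasurableSet G1 := hGm.inter (vis_meas hTme hAm n _)
  have hGd : MeasurableSet (G \ G1) := hGm.diff hG1m
  obtain ⟨S, hSG, hSm, hS, hbound⟩ := core_step μ hTme hB n p hn1 hτ hρ0 hl0 hl1 hAc hG1m
    (fun x hx => hx.2) ι (nm_MF (fam_meas hTme hB) (Zs m n N))
  rw [← ha, ← hLa] at hbound
  refine ⟨S, hSG.trans Set.inter_subset_left, hSm, ?_, ?_⟩
  · have hinfo := (wd_info hTm hB (le_max_left p k1) n (Zs m n N)).trans (hslow n N)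
    have hmk := vis_markov μ hTme hAm n hGd (r := ρ * n) (by
      intro x hx
      by_contra hcon
      exact hx.2 ⟨hx.1, (not_le.1 hcon).le⟩)
    have hVd : ∑ i ∈ Finset.range n, μ.real ((G \ G1) ∩ T^[i] ⁻¹' A) ≤ V n G :=
      Finset.sum_le_sum fun i _ => measureReal_mono
        (Set.inter_subset_inter_left _ Set.sdiff_subset) (measure_ne_top _ _)
    have hadd := IF_add μ (hw n) hGd (Set.disjoint_sdiff_right (s := G1) (t := G))
    rw [Set.union_sdiff_cancel Set.inter_subset_left] at hadd
    have hId := hIF n (G \ G1)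
    have hG1β : μ.real G1 ≤ β := measureReal_mono Set.inter_subset_left (measure_ne_top _ _)
    have hCm := mul_le_mul_of_nonneg_left (hmk.trans hVd) hC0
    have hCm2 : C * (ρ * n * μ.real (G \ G1)) = μ.real (G \ G1) * (n * La) := by
      rw [← hCρ]; ring
    have hlow : c * n * β - c * β / 8 * n - 2 ≤ IF μ (wd T B n p) G1 := by
      linarith
    have hκ : 2 * ρ * Real.log (l⁻¹) + a * l ≤ c / 8 := by linarith
    have h7 : μ.real G1 * (Real.log (Fintype.card ι + 1) +
          (2 * ρ * Real.log (l⁻¹) + a * l) * n) ≤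
        Real.log (Fintype.card ι + 1) + β * (c / 8 * n) := by
      rw [mul_add]
      have t1 : μ.real G1 * Real.log (Fintype.card ι + 1) ≤ 1 * Real.log (Fintype.card ι + 1) := by
        gcongr; exact hG1β.trans hβ1
      have t2 : μ.real G1 * ((2 * ρ * Real.log (l⁻¹) + a * l) * n) ≤ β * (c / 8 * n) := by
        gcongr
      linarith
    have h8 : δ n * n ≤ c * β / 8 * n := by gcongr
    have h9 : c * β / 4 * n ≤ μ.real S * (n * (La + 1)) := by
      have : 0 ≤ μ.real S * n := by positivity
      have h10 : 0 < c * β * n := by positivity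
      linarith
    have h10 : c * β / 4 ≤ μ.real S * (La + 1) := by
      have : c * β / 4 * n ≤ (μ.real S * (La + 1)) * n := by linarith
      exact le_of_mul_le_mul_right this (by positivity)
    rw [div_le_iff₀ (by positivity)]
    linarith
  · intro z hz
    obtain ⟨y, hy1, hy2, hy3⟩ := hS z hz
    exact ⟨y, fun i => (hy1 i).1, fun i => Eqv_of_nm (hy2 i), hy3⟩

end ClaimC

end DC2

set_option linter.unusedSectionVars false

namespace DC2

open MeasureTheory Topology

section Step

variable {X : Type*} [MetricSpace X] [CompactSpace X] [MeasurableSpace X] [BorelSpace X]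

/-- The outcome of the measure theoretic part. -/
structure Sys (T : X → X) where
  μ : Measure X
  prob : IsProbabilityMeasure μ
  B : ℕ → Set X
  m : ℕ → ℕ
  τ : ℝ
  ρ : ℝ
  Y : Set X
  hB : ∀ j, MeasurableSet (B j)
  hmono : Monotone m
  htend : Tendsto m atTop atTop
  hfine : ∀ ε > 0, ∃ k : ℕ, ∀ x y, (∀ j < k, (x ∈ B j ↔ y ∈ B j)) → dist x y < ε
  hτ : 0 < τ
  hρ : 0 < ρ
  hτd : ∀ i x y, (∀ j < m i, (x ∈ B j ↔ y ∈ B j)) → dist x y < τ / 3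
  hY : MeasurableSet Y
  hY0 : 0 < μ Y
  claim : ∀ G ⊆ Y, MeasurableSet G → 0 < μ G →
      ∀ (ι : Type) [Fintype ι] (n0 : ℕ), ∃ n ≥ n0, ∃ η > 0, ∀ N, ∃ S ⊆ G, MeasurableSet S ∧
        η ≤ μ.real S ∧ ∀ z ∈ S, ∃ y : ι → X, (∀ l, y l ∈ G) ∧ (∀ l, Eqv T B m n N (y l) z) ∧
          ∀ l l', l ≠ l' → ρ * n ≤ sepc T τ n (y l) (y l')

lemma exists_sys (T : X → X) (hT : Continuous T)
    (hent : 0 < Dynamics.coverEntropy T (Set.univ : Set X)) : Nonempty (Sys T) := by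
  obtain ⟨μ, hμ, B, m, τ, ρ, Y, h1, h2, h3, h4, h5, h6, h7, h8, h9, h10⟩ := claim_c T hT hent
  exact ⟨⟨μ, hμ, B, m, τ, ρ, Y, h1, h2, h3, h4, h5, h6, h7, h8, h9, h10⟩⟩

lemma Eqv.symm {T : X → X} {B : ℕ → Set X} {m : ℕ → ℕ} {a b : ℕ} {x y : X}
    (h : Eqv T B m a b x y) : Eqv T B m a b y x := fun i h1 h2 j hj => (h i h1 h2 j hj).symm

lemma Eqv.trans {T : X → X} {B : ℕ → Set X} {m : ℕ → ℕ} {a b : ℕ} {x y z : X}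
    (h : Eqv T B m a b x y) (h' : Eqv T B m a b y z) : Eqv T B m a b x z :=
  fun i h1 h2 j hj => (h i h1 h2 j hj).trans (h' i h1 h2 j hj)

lemma Eqv.mono {T : X → X} {B : ℕ → Set X} {m : ℕ → ℕ} {a b a' b' : ℕ} {x y : X}
    (h : Eqv T B m a b x y) (ha : a ≤ a') (hb : b' ≤ b) : Eqv T B m a' b' x y :=
  fun i h1 h2 j hj => h i (ha.trans h1) (lt_of_lt_of_le h2 hb) j hj

lemma nm_of_Eqv {T : X → X} {B : ℕ → Set X} {m : ℕ → ℕ} {n N : ℕ} {x y : X}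
    (h : Eqv T B m n N x y) : nm (fam T B) (Zs m n N) x = nm (fam T B) (Zs m n N) y := by
  rw [nm_eq_iff]
  rintro ⟨i, j⟩ hq
  rw [mem_Zs] at hq
  exact h i hq.1.1 hq.1.2 j hq.2

/-- pigeonhole for measures -/
lemma exists_pos_fiber (μ : Measure X) {α : Type*} [Finite α] {f : X → α} {G : Set X}
    (hG : 0 < μ G) : ∃ a, 0 < μ (G ∩ f ⁻¹' {a}) := by
  by_contra hcon
  push Not at hcon
  have : μ G ≤ 0 := by
    have e : G = ⋃ a, G ∩ f ⁻¹' {a} := by ext x; simp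
    rw [e]
    refine le_of_eq (measure_iUnion_null fun a => le_antisymm (hcon a) bot_le)
  exact absurd hG (not_lt.2 this)

lemma exists_large (μ : Measure X) [IsProbabilityMeasure μ] {α : Type*} [Fintype α] [Nonempty α]
    (g : α → Set X) {S : Set X} (hS : S ⊆ ⋃ a, g a) {η : ℝ} (h : η ≤ μ.real S) :
    ∃ a, η / Fintype.card α ≤ μ.real (g a) := by
  by_contra hcon
  push Not at hcon
  have h1 : μ.real S ≤ ∑ a, μ.real (g a) :=
    (measureReal_mono hS (measure_ne_top _ _)).trans (measureReal_iUnion_fintype_le _)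
  have h2 : ∑ a, μ.real (g a) < ∑ _a : α, η / Fintype.card α :=
    Finset.sum_lt_sum_of_nonempty Finset.univ_nonempty fun a _ => hcon a
  rw [Finset.sum_const, nsmul_eq_mul, Finset.card_univ, mul_div_cancel₀] at h2
  · linarith
  · have := Fintype.card_pos (α := α)
    positivity

lemma exists_all_large (μ : Measure X) [IsProbabilityMeasure μ] {α : Type*} [Fintype α]
    (g : ℕ → α → Set X) (hanti : ∀ a, Antitone fun N => g N a)
    (S : ℕ → Set X) {η : ℝ} (hη : 0 < η) (hS : ∀ N, S N ⊆ ⋃ a, g N a) (h : ∀ N, η ≤ μ.real (S N)) :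
    ∃ a, ∃ η' > 0, ∀ N, η' ≤ μ.real (g N a) := by
  have hne : Nonempty α := by
    by_contra hcon
    rw [not_nonempty_iff] at hcon
    have h1 : S 0 ⊆ ∅ := (hS 0).trans (by simp)
    have h2 := h 0
    rw [Set.subset_empty_iff.1 h1] at h2
    simp at h2
    linarith
  choose c hc using fun N => exists_large μ (g N) (hS N) (h N)
  obtain ⟨a, ha⟩ := Finite.exists_infinite_fiber c
  rw [Set.infinite_coe_iff] at ha
  refine ⟨a, η / Fintype.card α, by have := Fintype.card_pos (α := α); positivity, fun N => ?_⟩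
  obtain ⟨M, hM, hMN⟩ := ha.exists_gt N
  have h1 := hc M
  rw [show c M = a from hM] at h1
  exact h1.trans (measureReal_mono (hanti a hMN.le) (measure_ne_top _ _))

lemma measure_iInter_pos (μ : Measure X) [IsProbabilityMeasure μ] (g : ℕ → Set X)
    (hg : ∀ N, MeasurableSet (g N)) (hanti : Antitone g) {η : ℝ} (hη : 0 < η)
    (h : ∀ N, η ≤ μ.real (g N)) : 0 < μ (⋂ N, g N) := by
  have ht := tendsto_measure_iInter_atTop (μ := μ) (fun i => (hg i).nullMeasurableSet) hanti
    ⟨0, measure_ne_top _ _⟩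
  refine lt_of_lt_of_le (ENNReal.ofReal_pos.2 hη) (ge_of_tendsto' ht fun N => ?_)
  rw [Function.comp_apply, ENNReal.ofReal_le_iff_le_toReal (measure_ne_top _ _)]
  exact h N

/-- Separation transfers along names. -/
lemma sep_transfer {T : X → X} (s : Sys T) {n n1 : ℕ} {x x' y y' : X}
    (hn : (n : ℝ) ≤ s.ρ / 2 * n1)
    (hx : Eqv T s.B s.m n n1 x y) (hx' : Eqv T s.B s.m n n1 x' y')
    (hsep : s.ρ * n1 ≤ sepc T s.τ n1 y y') : s.ρ / 2 * n1 ≤ sepc T (s.τ / 3) n1 x x' := by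
  have h1 : sepc T s.τ n1 y y' ≤ n + sepc T (s.τ / 3) n1 x x' := by
    classical
    unfold sepc
    calc _ ≤ (Finset.range n ∪ (Finset.range n1).filter
          fun i => s.τ / 3 ≤ dist (T^[i] x) (T^[i] x')).card := by
          refine Finset.card_le_card ?_
          intro i hi
          rw [Finset.mem_filter, Finset.mem_range] at hi
          rw [Finset.mem_union, Finset.mem_filter, Finset.mem_range, Finset.mem_range]
          by_cases hin : i < n
          · exact Or.inl hin
          · refine Or.inr ⟨hi.1, ?_⟩
            have d1 := s.hτd i _ _ (hx i (not_lt.1 hin) hi.1)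
            have d2 := s.hτd i _ _ (hx' i (not_lt.1 hin) hi.1)
            have := dist_triangle4 (T^[i] y) (T^[i] x) (T^[i] x') (T^[i] y')
            rw [dist_comm] at d1
            linarith [hi.2]
      _ ≤ n + _ := by
          refine (Finset.card_union_le _ _).trans ?_
          rw [Finset.card_range]
  have h2 : (sepc T s.τ n1 y y' : ℝ) ≤ n + sepc T (s.τ / 3) n1 x x' := by exact_mod_cast h1
  linarith

lemma step {T : X → X} (hT : Measurable T) (s : Sys T) (ι : Type) [Fintype ι] (n n' : ℕ)
    (hnn : n ≤ n') {ε : ℝ} (hε : 0 < ε) {Γ : Set X} (hΓY : Γ ⊆ s.Y) (hΓ : MeasurableSet Γ)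
    (hΓ0 : 0 < s.μ Γ) (D : ι → Set X)
    (hP : ∀ z ∈ Γ, ∀ N l, ∃ x ∈ D l, Eqv T s.B s.m n N x z) :
    ∃ n1 ≥ n', ∃ Γ' ⊆ s.Y, MeasurableSet Γ' ∧ 0 < s.μ Γ' ∧ ∃ D' : ι → Set X,
      (∀ l, D' l ⊆ D l) ∧ (∀ l, ∀ x ∈ D' l, ∀ y ∈ D' l, dist x y < ε) ∧
      (∀ l l', ∀ x ∈ D' l, ∀ y ∈ D' l', Eqv T s.B s.m n n' x y) ∧
      (∀ l l', l ≠ l' → ∀ x ∈ D' l, ∀ y ∈ D' l', s.ρ / 2 * n1 ≤ sepc T (s.τ / 3) n1 x y) ∧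
      (∀ z ∈ Γ', ∀ N l, ∃ x ∈ D' l, Eqv T s.B s.m n1 N x z) := by
  classical
  have := s.prob
  have hfm := fam_meas hT s.hB
  obtain ⟨b, hb⟩ := exists_pos_fiber s.μ (f := nm (fam T s.B) (Zs s.m n n')) hΓ0
  set Γc := Γ ∩ nm (fam T s.B) (Zs s.m n n') ⁻¹' {b} with hΓc
  have hΓcm : MeasurableSet Γc := hΓ.inter (nm_MF hfm _ b)
  obtain ⟨n1, hn1, η, hη, hS⟩ := s.claim Γc (Set.inter_subset_left.trans hΓY) hΓcm hb ι
    (max n' ⌈2 * (n : ℝ) / s.ρ⌉₊)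
  have hn1' : n' ≤ n1 := (le_max_left _ _).trans hn1
  have hn1r : (n : ℝ) ≤ s.ρ / 2 * n1 := by
    have h1 : ⌈2 * (n : ℝ) / s.ρ⌉₊ ≤ n1 := (le_max_right _ _).trans hn1
    have h2 := Nat.ceil_le.1 h1
    rw [div_le_iff₀ s.hρ] at h2
    linarith
  choose S hSG hSm hSη hSz using hS
  obtain ⟨k, hk⟩ := s.hfine ε hε
  let Z : Finset (ℕ × ℕ) := R 0 1 k ∪ Zs s.m 0 n1
  let χ : X → (Z → Bool) := nm (fam T s.B) Z
  have hχd : ∀ x y, χ x = χ y → dist x y < ε := by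
    intro x y h
    have h := (nm_eq_iff _ _ _ _).1 h
    refine hk x y fun j hj => ?_
    exact h (0, j) (Finset.mem_union_left _ (by rw [mem_R]; simp [hj]))
  have hχe : ∀ x y, χ x = χ y → Eqv T s.B s.m 0 n1 x y := by
    intro x y h
    have h := (nm_eq_iff _ _ _ _).1 h
    intro i _ hi j hj
    exact h (i, j) (Finset.mem_union_right _ (by rw [mem_Zs]; simp [hi, hj]))
  let ok : (ι → (Z → Bool)) → Prop := fun C => ∃ y : ι → X,
    (∀ l x, χ x = C l → Eqv T s.B s.m n n1 x (y l)) ∧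
    (∀ l l', Eqv T s.B s.m n n' (y l) (y l')) ∧
    (∀ l l', l ≠ l' → s.ρ * n1 ≤ sepc T s.τ n1 (y l) (y l'))
  let good : ℕ → (ι → (Z → Bool)) → Set X := fun N C =>
    {z | ∀ l, ∃ x ∈ D l, χ x = C l ∧ Eqv T s.B s.m n1 N x z}
  have hgm : ∀ N C, MeasurableSet (good N C) := by
    intro N C
    have e : good N C = nm (fam T s.B) (Zs s.m n1 N) ⁻¹'
        (nm (fam T s.B) (Zs s.m n1 N) '' good N C) := by
      refine Set.Subset.antisymm (Set.subset_preimage_image _ _) ?_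
      rintro z ⟨w, hw, hwz⟩ l
      obtain ⟨x, hx, hx1, hx2⟩ := hw l
      exact ⟨x, hx, hx1, hx2.trans (Eqv_of_nm hwz)⟩
    rw [e]
    exact (nm_MF hfm _).preimage _
  have hganti : ∀ C, Antitone fun N => good N C := by
    intro C N M hNM z hz l
    obtain ⟨x, hx, hx1, hx2⟩ := hz l
    exact ⟨x, hx, hx1, hx2.mono le_rfl hNM⟩
  obtain ⟨⟨C, y, hyC, hy1, hy2⟩, η', hη', hlarge⟩ := exists_all_large s.μ
    (α := {C // ok C}) (fun N C => s.Y ∩ good N C.1)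
    (fun C N M hNM => Set.inter_subset_inter_right _ (hganti C.1 hNM)) (fun N => S (max N n1)) hη
    (by
      intro N z hz
      obtain ⟨y, hyΓ, hyz, hysep⟩ := hSz _ z hz
      choose x hxD hxy using fun l => hP (y l) (hyΓ l).1 (max N n1) l
      have hok : ok (fun l => χ (x l)) := by
        refine ⟨y, fun l x' hx' => ?_, fun l l' => ?_, hysep⟩
        · exact ((hχe _ _ hx').mono (Nat.zero_le _) le_rfl).trans
            ((hxy l).mono le_rfl (le_max_right _ _))
        · exact Eqv_of_nm ((hyΓ l).2.trans (hyΓ l').2.symm)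
      refine Set.mem_iUnion.2 ⟨⟨_, hok⟩, hΓY (hSG _ hz).1, fun l => ⟨x l, hxD l, rfl, ?_⟩⟩
      exact ((hxy l).mono (hnn.trans hn1') (le_max_left _ _)).trans
        ((hyz l).mono le_rfl (le_max_left _ _)))
    (fun N => hSη _)
  refine ⟨n1, hn1', ⋂ N, s.Y ∩ good N C, ?_, ?_, ?_, fun l => D l ∩ {x | χ x = C l}, ?_, ?_, ?_, ?_, ?_⟩
  · exact fun z hz => (Set.mem_iInter.1 hz 0).1
  · exact MeasurableSet.iInter fun N => s.hY.inter (hgm N C)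
  · exact measure_iInter_pos s.μ _ (fun N => s.hY.inter (hgm N C))
      (fun N M hNM => Set.inter_subset_inter_right _ (hganti C hNM)) hη' hlarge
  · exact fun l => Set.inter_subset_left
  · intro l x hx y hy
    exact hχd x y (hx.2.trans hy.2.symm)
  · intro l l' x hx x' hx'
    exact (((hyC l x hx.2).mono le_rfl hn1').trans (hy1 l l')).trans
      ((hyC l' x' hx'.2).mono le_rfl hn1').symm
  · intro l l' hll x hx x' hx'
    exact sep_transfer s hn1r (hyC l x hx.2) (hyC l' x' hx'.2) (hy2 l l' hll)
  · intro z hz N l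
    obtain ⟨x, hx, hx1, hx2⟩ := (Set.mem_iInter.1 hz N).2 l
    exact ⟨x, ⟨hx, hx1⟩, hx2⟩

end Step

end DC2

set_option linter.unusedSectionVars false

namespace DC2

open MeasureTheory Topology

section Final

lemma ctf_le_one {X : Type*} [MetricSpace X] (T : X → X) (x y : X) (t : ℝ) (n : ℕ) :
    closeTimesFraction T x y t n ≤ 1 := by
  unfold closeTimesFraction
  refine div_le_one_of_le₀ ?_ (by positivity)
  have := Finset.card_filter_le (Finset.range n) (fun i => dist (T^[i] x) (T^[i] y) < t)
  rw [Finset.card_range] at this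
  exact_mod_cast this

lemma ctf_nonneg {X : Type*} [MetricSpace X] (T : X → X) (x y : X) (t : ℝ) (n : ℕ) :
    0 ≤ closeTimesFraction T x y t n := by
  unfold closeTimesFraction
  positivity

lemma isDC2_of {X : Type*} [MetricSpace X] (T : X → X) (x y : X)
    (h1 : ∀ t > 0, ∀ ε > 0, ∃ᶠ n in atTop, 1 - ε ≤ closeTimesFraction T x y t n)
    (t₀ r : ℝ) (ht₀ : 0 < t₀) (hr : r < 1)
    (h2 : ∃ᶠ n in atTop, closeTimesFraction T x y t₀ n ≤ r) : IsDC2Pair T x y := by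
  have hb1 : ∀ t, IsBoundedUnder (· ≤ ·) atTop (fun n : ℕ => closeTimesFraction T x y t n) :=
    fun t => isBoundedUnder_of ⟨1, fun n => ctf_le_one T x y t n⟩
  have hb2 : ∀ t, IsBoundedUnder (· ≥ ·) atTop (fun n : ℕ => closeTimesFraction T x y t n) :=
    fun t => isBoundedUnder_of ⟨0, fun n => ctf_nonneg T x y t n⟩
  refine ⟨fun t ht => le_antisymm ?_ ?_, t₀, ht₀, ?_⟩
  · exact limsup_le_of_le (hb2 t).isCoboundedUnder_le (Eventually.of_forall fun n =>
      ctf_le_one T x y t n)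
  · refine le_of_forall_pos_sub_le fun ε hε => ?_
    exact le_limsup_of_frequently_le (h1 t ht ε hε) (hb1 t)
  · exact (liminf_le_of_frequently_le h2 (hb2 t₀)).trans_lt hr

variable {X : Type*} [MetricSpace X] [CompactSpace X] [MeasurableSpace X] [BorelSpace X]

lemma sep_closure {T : X → X} (hT : Continuous T) {t : ℝ} {n : ℕ} {r : ℝ} {P Q : Set X}
    (h : ∀ x ∈ P, ∀ y ∈ Q, r ≤ sepc T t n x y) {x y : X} (hx : x ∈ closure P)
    (hy : y ∈ closure Q) : r ≤ sepc T t n x y := by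
  have hxy : (x, y) ∈ closure (P ×ˢ Q) := by rw [closure_prod_eq]; exact ⟨hx, hy⟩
  have hev : ∀ᶠ q : X × X in 𝓝 (x, y), ∀ i ∈ (Finset.range n).filter
      (fun i => ¬ t ≤ dist (T^[i] x) (T^[i] y)), dist (T^[i] q.1) (T^[i] q.2) < t := by
    rw [Filter.eventually_all_finset]
    intro i hi
    have hi := (Finset.mem_filter.1 hi).2
    have hc : Continuous fun q : X × X => dist (T^[i] q.1) (T^[i] q.2) :=
      ((hT.iterate i).comp continuous_fst).dist ((hT.iterate i).comp continuous_snd)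
    exact hc.continuousAt.eventually (gt_mem_nhds (not_le.1 hi))
  obtain ⟨q, hq, hqP⟩ := ((mem_closure_iff_frequently.1 hxy).and_eventually hev).exists
  refine (h q.1 hq.1 q.2 hq.2).trans ?_
  unfold sepc
  have : (Finset.range n).filter (fun i => t ≤ dist (T^[i] q.1) (T^[i] q.2)) ⊆
      (Finset.range n).filter (fun i => t ≤ dist (T^[i] x) (T^[i] y)) := by
    intro i hi
    rw [Finset.mem_filter] at hi ⊢
    refine ⟨hi.1, ?_⟩
    by_contra hcon
    exact absurd (hqP i (Finset.mem_filter.2 ⟨hi.1, hcon⟩)) (not_lt.2 hi.2)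
  exact_mod_cast Finset.card_le_card this

lemma dist_closure {T : X → X} (hT : Continuous T) {t : ℝ} {i : ℕ} {P Q : Set X}
    (h : ∀ x ∈ P, ∀ y ∈ Q, dist (T^[i] x) (T^[i] y) ≤ t) {x y : X} (hx : x ∈ closure P)
    (hy : y ∈ closure Q) : dist (T^[i] x) (T^[i] y) ≤ t := by
  have hxy : (x, y) ∈ closure (P ×ˢ Q) := by rw [closure_prod_eq]; exact ⟨hx, hy⟩
  have hc : Continuous fun q : X × X => dist (T^[i] q.1) (T^[i] q.2) :=
    ((hT.iterate i).comp continuous_fst).dist ((hT.iterate i).comp continuous_snd)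
  have hcl : IsClosed {q : X × X | dist (T^[i] q.1) (T^[i] q.2) ≤ t} :=
    isClosed_le hc continuous_const
  exact closure_minimal (fun q hq => h q.1 hq.1 q.2 hq.2) hcl hxy

/-- Invariant of the construction. -/
def Inv {T : X → X} (s : Sys T) (k : ℕ) (q : ℕ × Set X × (List Bool → Set X)) : Prop :=
  q.2.1 ⊆ s.Y ∧ MeasurableSet q.2.1 ∧ 0 < s.μ q.2.1 ∧
    ∀ z ∈ q.2.1, ∀ N, ∀ l : List Bool, l.length = k → ∃ x ∈ q.2.2 l, Eqv T s.B s.m q.1 N x z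

/-- Relation between successive stages. -/
def Rel {T : X → X} (s : Sys T) (k : ℕ) (q q' : ℕ × Set X × (List Bool → Set X)) : Prop :=
  (k + 2) * (q.1 + 1) ≤ q'.1 ∧
  (∀ l : List Bool, l.length = k → ∀ b, q'.2.2 (b :: l) ⊆ q.2.2 l) ∧
  (∀ l : List Bool, l.length = k + 1 → ∀ x ∈ q'.2.2 l, ∀ y ∈ q'.2.2 l,
    dist x y < 1 / ((k : ℝ) + 1)) ∧
  (∀ l l' : List Bool, l.length = k + 1 → l'.length = k + 1 → ∀ x ∈ q'.2.2 l, ∀ y ∈ q'.2.2 l',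
    Eqv T s.B s.m q.1 ((k + 2) * (q.1 + 1)) x y) ∧
  (∀ l l' : List Bool, l.length = k + 1 → l'.length = k + 1 → l ≠ l' →
    ∀ x ∈ q'.2.2 l, ∀ y ∈ q'.2.2 l', s.ρ / 2 * q'.1 ≤ sepc T (s.τ / 3) q'.1 x y)

lemma tree_step {T : X → X} (hT : Measurable T) (s : Sys T) (k : ℕ)
    (q : ℕ × Set X × (List Bool → Set X)) (hq : Inv s k q) :
    ∃ q', Inv s (k + 1) q' ∧ Rel s k q q' := by
  obtain ⟨n, Γ, D⟩ := q
  obtain ⟨h1, h2, h3, h4⟩ := hq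
  simp only at h1 h2 h3 h4
  obtain ⟨n1, hn1, Γ', hY', hm', hp', D', g1, g2, g3, g4, g5⟩ :=
    step hT s (List.Vector Bool (k + 1)) n ((k + 2) * (n + 1)) (by nlinarith)
      (ε := 1 / ((k : ℝ) + 1)) (by positivity) h1 h2 h3 (fun l => D l.1.tail)
      (fun z hz N l => h4 z hz N l.1.tail (by rw [List.length_tail, l.2]; rfl))
  have key : ∀ (l : List Bool) (hl : l.length = k + 1),
      (if h : l.length = k + 1 then D' ⟨l, h⟩ else ∅) = D' ⟨l, hl⟩ := by
    intro l hl; rw [dif_pos hl]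
  refine ⟨(n1, Γ', fun l => if h : l.length = k + 1 then D' ⟨l, h⟩ else ∅),
    ⟨hY', hm', hp', ?_⟩, hn1, ?_, ?_, ?_, ?_⟩
  · intro z hz N l hl
    simp only [key l hl]
    exact g5 z hz N ⟨l, hl⟩
  · intro l hl b
    have hl' : (b :: l).length = k + 1 := by simp [hl]
    simp only [key _ hl']
    exact g1 ⟨b :: l, hl'⟩
  · intro l hl
    simp only [key _ hl]
    exact g2 ⟨l, hl⟩
  · intro l l' hl hl'
    simp only [key _ hl, key _ hl']
    exact g3 ⟨l, hl⟩ ⟨l', hl'⟩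
  · intro l l' hl hl' hne
    simp only [key _ hl, key _ hl']
    exact g4 ⟨l, hl⟩ ⟨l', hl'⟩ (fun h => hne (congrArg Subtype.val h))

lemma exists_tree {T : X → X} (hT : Measurable T) (s : Sys T) :
    ∃ q : ℕ → ℕ × Set X × (List Bool → Set X), (∀ k, Inv s k (q k)) ∧
      ∀ k, Rel s k (q k) (q (k + 1)) := by
  choose! nxt hnxt1 hnxt2 using tree_step hT s
  let q : ℕ → ℕ × Set X × (List Bool → Set X) := fun k =>
    Nat.rec (0, s.Y, fun _ => Set.univ) (fun k q => nxt k q) k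
  have hI : ∀ k, Inv s k (q k) := by
    intro k
    induction k with
    | zero =>
      exact ⟨subset_rfl, s.hY, s.hY0, fun z _ N l _ => ⟨z, Set.mem_univ _,
        fun _ _ _ _ _ => Iff.rfl⟩⟩
    | succ k ih => exact hnxt1 k (q k) ih
  exact ⟨q, hI, fun k => hnxt2 k (q k) (hI k)⟩

lemma exists_map {T : X → X} (hT : Continuous T) (s : Sys T) :
    ∃ (f : (ℕ → Bool) → X) (n : ℕ → ℕ), Continuous f ∧
      (∀ k, (k + 2) * (n k + 1) ≤ n (k + 1)) ∧
      (∀ k u v, ∀ i, n k ≤ i → i < (k + 2) * (n k + 1) → ∀ t, (∀ x y,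
        (∀ j < s.m i, (x ∈ s.B j ↔ y ∈ s.B j)) → dist x y ≤ t) →
          dist (T^[i] (f u)) (T^[i] (f v)) ≤ t) ∧
      (∀ u v, u ≠ v → ∀ᶠ k in atTop,
        s.ρ / 2 * n (k + 1) ≤ sepc T (s.τ / 3) (n (k + 1)) (f u) (f v)) := by
  obtain ⟨q, hI, hR⟩ := exists_tree hT.measurable s
  let A : List Bool → Set X := fun l => closure ((q l.length).2.2 l)
  have hne : ∀ l, (A l).Nonempty := by
    intro l
    obtain ⟨-, -, h3, h4⟩ := hI l.length
    obtain ⟨z, hz⟩ := nonempty_of_measure_ne_zero h3.ne'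
    obtain ⟨x, hx, -⟩ := h4 z hz 0 l rfl
    exact ⟨x, subset_closure hx⟩
  have hanti : CantorScheme.ClosureAntitone A := by
    intro l b
    simp only [A, closure_closure]
    exact closure_mono ((hR l.length).2.1 l rfl b)
  have hvan : CantorScheme.VanishingDiam A := by
    intro u
    rw [← tendsto_add_atTop_iff_nat 1]
    have hz : Tendsto (fun k : ℕ => ENNReal.ofReal (1 / ((k : ℝ) + 1))) atTop (𝓝 0) := by
      have := ENNReal.tendsto_ofReal (tendsto_one_div_add_atTop_nhds_zero_nat (𝕜 := ℝ))
      rwa [ENNReal.ofReal_zero] at this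
    refine tendsto_of_tendsto_of_tendsto_of_le_of_le tendsto_const_nhds hz (fun _ => bot_le)
      fun k => ?_
    have hlen := PiNat.res_length u (k + 1)
    simp only [A, hlen]
    rw [Metric.ediam_closure]
    refine Metric.ediam_le fun x hx y hy => ?_
    rw [edist_dist]
    exact ENNReal.ofReal_le_ofReal ((hR k).2.2.1 _ hlen x hx y hy).le
  have huniv := CantorScheme.ClosureAntitone.map_of_vanishingDiam hvan hanti hne
  let f : (ℕ → Bool) → X := fun u =>
    (CantorScheme.inducedMap A).2 ⟨u, by rw [huniv]; trivial⟩
  have hf : Continuous f := hvan.map_continuous.comp (Continuous.subtype_mk continuous_id _)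
  have hfm : ∀ u k, f u ∈ closure ((q k).2.2 (PiNat.res u k)) := by
    intro u k
    have := CantorScheme.map_mem (A := A) ⟨u, by rw [huniv]; trivial⟩ k
    simp only [A, PiNat.res_length] at this
    exact this
  refine ⟨f, fun k => (q k).1, hf, fun k => (hR k).1, ?_, ?_⟩
  · intro k u v i hi1 hi2 t ht
    refine dist_closure hT ?_ (hfm u (k + 1)) (hfm v (k + 1))
    intro x hx y hy
    exact ht _ _ ((hR k).2.2.2.1 _ _ (PiNat.res_length _ _) (PiNat.res_length _ _) x hx y hy
      i hi1 hi2)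
  · intro u v huv
    obtain ⟨j, hj⟩ := Function.ne_iff.1 huv
    filter_upwards [eventually_ge_atTop j] with k hk
    refine sep_closure hT ?_ (hfm u (k + 1)) (hfm v (k + 1))
    refine (hR k).2.2.2.2 _ _ (PiNat.res_length _ _) (PiNat.res_length _ _) ?_
    intro h
    exact hj (PiNat.res_eq_res.1 h (by omega))

lemma perfect_range {f : (ℕ → Bool) → X} (hf : Continuous f) (hinj : Function.Injective f) :
    Perfect (Set.range f) := by
  refine ⟨(isCompact_range hf).isClosed, ?_⟩
  rintro _ ⟨u, rfl⟩
  rw [accPt_iff_frequently]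
  have ht : Tendsto (fun n : ℕ => Function.update u n (!u n)) atTop (𝓝 u) := by
    rw [tendsto_pi_nhds]
    intro i
    refine tendsto_const_nhds.congr' ?_
    filter_upwards [eventually_gt_atTop i] with n hn
    rw [Function.update_of_ne hn.ne]
  have ht2 := (hf.tendsto u).comp ht
  refine ht2.frequently (Frequently.of_forall fun n => ⟨?_, Set.mem_range_self _⟩)
  intro h
  have := congrFun (hinj h) n
  simp at this

lemma main_aux (T : X → X) (hT : Continuous T)
    (hent : 0 < Dynamics.coverEntropy T (Set.univ : Set X)) :
    ∃ E : Set X, E.Nonempty ∧ IsCompact E ∧ Perfect E ∧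
      ∀ x ∈ E, ∀ y ∈ E, x ≠ y → IsDC2Pair T x y := by
  obtain ⟨s⟩ := exists_sys T hT hent
  obtain ⟨f, n, hf, hn, hclose, hsep⟩ := exists_map hT s
  have hn1 : ∀ k, k ≤ n k := by
    intro k
    induction k with
    | zero => exact Nat.zero_le _
    | succ k ih => have := hn k; nlinarith
  have hinj : Function.Injective f := by
    intro u v huv
    by_contra hne
    obtain ⟨k, hk⟩ := (hsep u v hne).exists
    rw [huv, sepc_self T (by have := s.hτ; positivity)] at hk
    have h1 : (1 : ℝ) ≤ n (k + 1) := by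
      have := hn1 (k + 1)
      exact_mod_cast (by omega : 1 ≤ n (k + 1))
    have := s.hρ
    have : 0 < s.ρ / 2 * n (k + 1) := by positivity
    push_cast at hk
    linarith
  refine ⟨Set.range f, Set.range_nonempty f, isCompact_range hf, perfect_range hf hinj, ?_⟩
  rintro _ ⟨u, rfl⟩ _ ⟨v, rfl⟩ huv
  have huv' : u ≠ v := fun h => huv (by rw [h])
  refine isDC2_of T _ _ ?_ (s.τ / 3) (1 - s.ρ / 2) (by have := s.hτ; positivity)
    (by have := s.hρ; linarith) ?_
  · intro t ht ε hε
    obtain ⟨K, hK⟩ := s.hfine (t / 2) (by positivity)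
    have hev : ∀ᶠ k : ℕ in atTop, K ≤ s.m k := s.htend.eventually_ge_atTop K
    obtain ⟨k1, hk1⟩ := eventually_atTop.1 hev
    obtain ⟨k2, hk2⟩ := exists_nat_gt (1 / ε)
    rw [frequently_atTop]
    intro M
    set k := max M (max k1 k2) with hk
    have hkM : M ≤ k := le_max_left _ _
    have hkk1 : k1 ≤ k := (le_max_left _ _).trans (le_max_right _ _)
    have hkk2 : k2 ≤ k := (le_max_right _ _).trans (le_max_right _ _)
    set n' := (k + 2) * (n k + 1) with hn'
    have hkn := hn1 k
    refine ⟨n', by nlinarith, ?_⟩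
    have hcl : ∀ i, n k ≤ i → i < n' → dist (T^[i] (f u)) (T^[i] (f v)) < t := by
      intro i h1 h2
      have := hclose k u v i h1 h2 (t / 2) fun x y hxy => (hK x y fun j hj =>
        hxy j (lt_of_lt_of_le hj (hk1 i (by omega)))).le
      linarith
    have hcard : n' - n k ≤ ((Finset.range n').filter
        (fun i => dist (T^[i] (f u)) (T^[i] (f v)) < t)).card := by
      rw [← Nat.card_Ico]
      refine Finset.card_le_card fun i hi => ?_
      rw [Finset.mem_Ico] at hi
      rw [Finset.mem_filter, Finset.mem_range]
      exact ⟨hi.2, hcl i hi.1 hi.2⟩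
    have hcard' : (n' : ℝ) - n k ≤ (((Finset.range n').filter
        (fun i => dist (T^[i] (f u)) (T^[i] (f v)) < t)).card : ℝ) := by
      have : n' ≤ n k + ((Finset.range n').filter
        (fun i => dist (T^[i] (f u)) (T^[i] (f v)) < t)).card := by omega
      have : (n' : ℝ) ≤ n k + (((Finset.range n').filter
        (fun i => dist (T^[i] (f u)) (T^[i] (f v)) < t)).card : ℝ) := by exact_mod_cast this
      linarith
    have hn'pos : (0 : ℝ) < n' := by
      have : 0 < n' := by positivity
      exact_mod_cast this
    unfold closeTimesFraction
    rw [le_div_iff₀ hn'pos]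
    refine le_trans ?_ hcard'
    have h3 : (n' : ℝ) = (k + 2) * (n k + 1) := by rw [hn']; push_cast; ring
    have h4 : 1 ≤ ε * (k + 2) := by
      have : (k2 : ℝ) ≤ k := by exact_mod_cast hkk2
      rw [div_lt_iff₀ hε] at hk2
      nlinarith
    have h5 : (n k : ℝ) ≤ ε * n' := by
      rw [h3]
      have h0 : (0 : ℝ) ≤ n k := by positivity
      nlinarith
    linarith
  · rw [frequently_atTop]
    intro M
    obtain ⟨k1, hk1⟩ := eventually_atTop.1 (hsep u v huv')
    set k := max M k1 with hk
    have hkk := hk1 k (le_max_right _ _)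
    have hkn := hn1 (k + 1)
    have hkM : M ≤ k := le_max_left _ _
    refine ⟨n (k + 1), by omega, ?_⟩
    have hpos : (0 : ℝ) < n (k + 1) := by
      have : 0 < n (k + 1) := by omega
      exact_mod_cast this
    unfold closeTimesFraction
    rw [div_le_iff₀ hpos]
    have hsum := Finset.card_filter_add_card_filter_not (s := Finset.range (n (k + 1)))
      (fun i => s.τ / 3 ≤ dist (T^[i] (f u)) (T^[i] (f v)))
    rw [Finset.card_range] at hsum
    simp only [not_le] at hsum
    unfold sepc at hkk
    have hsum' : (((Finset.range (n (k + 1))).filter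
        (fun i => s.τ / 3 ≤ dist (T^[i] (f u)) (T^[i] (f v)))).card : ℝ) +
        (((Finset.range (n (k + 1))).filter
        (fun i => dist (T^[i] (f u)) (T^[i] (f v)) < s.τ / 3)).card : ℝ) = n (k + 1) := by
      exact_mod_cast hsum
    linarith

end Final

end DC2

/-- **Positive topological entropy yields a Cantor DC2-scrambled set.** If `T` is a continuous
self-map of a compact metric space with positive topological entropy, then there exists a
nonempty compact perfect set `E ⊆ X` every pair of distinct points of which is DC2-scrambled. -/
theorem positive_entropy_implies_perfect_DC2 {X : Type*} [MetricSpace X] [CompactSpace X]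
    (T : X → X) (hT : Continuous T)
    (hent : 0 < Dynamics.coverEntropy T (Set.univ : Set X)) :
    ∃ E : Set X, E.Nonempty ∧ IsCompact E ∧ Perfect E ∧
      ∀ x ∈ E, ∀ y ∈ E, x ≠ y → IsDC2Pair T x y := by
  letI : MeasurableSpace X := borel X
  haveI : BorelSpace X := ⟨rfl⟩
  exact DC2.main_aux T hT hent
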